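/- The second barycentric subdivision of any collapsible finite simplicial complex carries a Morse shelling which uses exactly one critical tile, and this critical tile is a closed simplex (hence of index 0). -/

import Mathlib

/-!
Common combinatorial framework for Morse shellings of simplicial complexes,
following J.-Y. Welschinger, "Morse shellings out of discrete Morse functions".
-/

namespace MorseShelling

variable {V : Type*} [DecidableEq V] {W : Type*} [DecidableEq W]

/-- A (finite, combinatorial) simplicial complex: a downward-closed collection of
finite subsets (simplices) of the vertex type. -/
def IsComplex (K : Finset (Finset V)) : Prop :=
  ∀ σ ∈ K, ∀ τ ⊆ σ, τ ∈ K

/-- A relative simplicial complex `S = K \ L`, recorded as the pair `(K, L)`. -/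
structure RelCplx (V : Type*) where
  K : Finset (Finset V)
  L : Finset (Finset V)

/-- The faces of a relative simplicial complex. -/
def RelCplx.faces (S : RelCplx V) : Finset (Finset V) := S.K \ S.L

/-- Validity of a relative simplicial complex: both members are complexes and
`L` is a subcomplex of `K`. -/
def RelCplx.IsValid (S : RelCplx V) : Prop :=
  IsComplex S.K ∧ IsComplex S.L ∧ S.L ⊆ S.K

/-- Join of two collections of faces (on disjoint vertex supports). -/
def joinF (K₁ K₂ : Finset (Finset V)) : Finset (Finset V) :=
  (K₁ ×ˢ K₂).image fun p => p.1 ∪ p.2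

/-- Join of two relative simplicial complexes:
`(K₁ * K₂) \ ((L₁ * K₂) ∪ (K₁ * L₂))`. -/
def RelCplx.join (S₁ S₂ : RelCplx V) : RelCplx V :=
  ⟨joinF S₁.K S₂.K, joinF S₁.L S₂.K ∪ joinF S₁.K S₂.L⟩

/-- The star of a simplex `σ` in `K` : all faces `τ` with `σ ∪ τ ∈ K`. -/
def star (K : Finset (Finset V)) (σ : Finset V) : Finset (Finset V) :=
  K.filter fun τ => σ ∪ τ ∈ K

/-- The link of a simplex `σ` in `K` : all faces `τ` of the star disjoint from `σ`. -/
def link (K : Finset (Finset V)) (σ : Finset V) : Finset (Finset V) :=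
  K.filter fun τ => σ ∪ τ ∈ K ∧ σ ∩ τ = ∅

/-- The star of a simplex in a relative complex, `st_S(σ) = st_K(σ) \ st_L(σ)`. -/
def RelCplx.starR (S : RelCplx V) (σ : Finset V) : RelCplx V :=
  ⟨star S.K σ, star S.L σ⟩

/-- The link of a simplex in a relative complex, `lk_S(σ) = lk_K(σ) \ lk_L(σ)`. -/
def RelCplx.linkR (S : RelCplx V) (σ : Finset V) : RelCplx V :=
  ⟨link S.K σ, link S.L σ⟩

/-- The boundary complex of a simplex: all its proper faces (including `∅`). -/
def boundary (σ : Finset V) : Finset (Finset V) := σ.powerset.erase σ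

/-- First barycentric subdivision: the faces are the (possibly empty) flags
`∅ ≠ σ₀ ⊊ σ₁ ⊊ ... ⊊ σ_q` of nonempty faces of `K`, a nonempty face `σ` of `K`
becoming the vertex `σ̂ = σ`. By convention `sd ∅ = ∅`. -/
def sd (K : Finset (Finset V)) : Finset (Finset (Finset V)) :=
  if K = ∅ then ∅ else
    (K.erase ∅).powerset.filter fun c => ∀ a ∈ c, ∀ b ∈ c, a ⊆ b ∨ b ⊆ a

/-- First barycentric subdivision of a relative complex: `sd (K \ L) = sd K \ sd L`. -/
def RelCplx.sdR (S : RelCplx V) : RelCplx (Finset V) := ⟨sd S.K, sd S.L⟩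

/-- An (absolute) simplicial complex seen as a relative one. -/
def toRel (K : Finset (Finset V)) : RelCplx V := ⟨K, ∅⟩

/-- The vertex support of a relative complex. -/
def suppK (S : RelCplx V) : Finset V := S.K.sup id

/-- The ridges (codimension one faces) of a simplex. -/
def ridges (σ : Finset V) : Finset (Finset V) := σ.image fun v => σ.erase v

/-- The subcomplex of the simplex `σ` consisting of the faces contained in some
member of `R`. -/
def below (σ : Finset V) (R : Finset (Finset V)) : Finset (Finset V) :=
  σ.powerset.filter fun τ => ∃ ρ ∈ R, τ ⊆ ρ

/-- The restriction set of the basic tile `σ \ R`: the face spanned by the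
vertices opposite to the missing ridges `R`. -/
def restSet (σ : Finset V) (R : Finset (Finset V)) : Finset V :=
  σ.filter fun v => σ.erase v ∈ R

/-- A basic tile of dimension `n` and order `k`: an `n`-simplex deprived of `k`
of its ridges (together with all the faces contained in them). -/
def IsBasicTile (S : RelCplx V) (n k : ℕ) : Prop :=
  ∃ σ : Finset V, σ.card = n + 1 ∧ S.K = σ.powerset ∧
    ∃ R ⊆ ridges σ, R.card = k ∧ S.L = below σ R

/-- A Morse tile of dimension `n` and order `k`: a basic tile, possibly further
deprived of a unique face of higher codimension (its Morse face). -/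
def IsMorseTile (S : RelCplx V) (n k : ℕ) : Prop :=
  ∃ σ : Finset V, σ.card = n + 1 ∧ S.K = σ.powerset ∧
    ∃ R ⊆ ridges σ, R.card = k ∧
      (S.L = below σ R ∨
        ∃ μ ⊆ σ, μ ∉ below σ R ∧ μ.card + 2 ≤ σ.card ∧
          S.L = below σ R ∪ below σ {μ})

/-- A critical tile of dimension `n` and index `k`: either a closed simplex
(index `0`), or a basic tile of order `k` deprived of its restriction set
(this includes the dotted simplex for `k = 0` and the open simplex for `k = n`). -/
def IsCriticalTile (S : RelCplx V) (n k : ℕ) : Prop :=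
  ∃ σ : Finset V, σ.card = n + 1 ∧ S.K = σ.powerset ∧
    ((k = 0 ∧ S.L = ∅) ∨
      (k ≤ n ∧ ∃ R ⊆ ridges σ, R.card = k ∧
        S.L = below σ R ∪ below σ {restSet σ R}))

/-- A closed simplex, as a tile. -/
def IsClosedSimplexTile (S : RelCplx V) : Prop :=
  ∃ σ : Finset V, S.K = σ.powerset ∧ S.L = ∅

/-- An open simplex, as a tile: deprived of its whole boundary, incl. the empty face. -/
def IsOpenSimplexTile (S : RelCplx V) : Prop :=
  ∃ σ : Finset V, σ ≠ ∅ ∧ S.K = σ.powerset ∧ S.L = σ.powerset.erase σ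

/-- The closed simplex on vertex set `σ`, as a relative complex. -/
def closedT (σ : Finset V) : RelCplx V := ⟨σ.powerset, ∅⟩

/-- The open simplex on vertex set `σ`. -/
def openT (σ : Finset V) : RelCplx V := ⟨σ.powerset, σ.powerset.erase σ⟩

/-- The closed simplex deprived of its empty face, `σ̇` (the neutral tile when
`σ = ∅`, so that empty factors may be dropped from joins). -/
def dotT (σ : Finset V) : RelCplx V := ⟨σ.powerset, if σ = ∅ then ∅ else {∅}⟩

/-- The Morse tile `σ * θ̊ * τ̇`. -/
def splitTile (σ θ τ : Finset V) : RelCplx V :=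
  (closedT σ).join ((openT θ).join (dotT τ))

/-- A tiling of a relative simplicial complex by `N` relative facets: the tiles
are relative simplices whose underlying simplices are facets, and their faces
partition the faces of `S`. -/
structure Tiling (S : RelCplx W) (N : ℕ) where
  tile : Fin N → RelCplx W
  isFacet : ∀ i, ∃ σ ∈ S.K, (∀ τ ∈ S.K, σ ⊆ τ → τ = σ) ∧ (tile i).K = σ.powerset
  subL : ∀ i, (tile i).L ⊆ (tile i).K
  disj : ∀ i j, i ≠ j → Disjoint (tile i).faces (tile j).faces
  cover : (Finset.univ : Finset (Fin N)).biUnion (fun i => (tile i).faces) = S.faces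

/-- The union of the faces of the first `p` tiles of a tiling. -/
def Tiling.prefixFaces {S : RelCplx W} {N : ℕ} (T : Tiling S N) (p : ℕ) :
    Finset (Finset W) :=
  (Finset.univ.filter fun i : Fin N => (i : ℕ) < p).biUnion fun i => (T.tile i).faces

/-- A tiling is a shelling when each of the sets of faces of `S_p = K_p \ L`
is a relative subcomplex, i.e. `L ∪ (tiles of index < p)` is a complex. -/
def Tiling.IsShelling {S : RelCplx W} {N : ℕ} (T : Tiling S N) : Prop :=
  ∀ p ≤ N, IsComplex (S.L ∪ T.prefixFaces p)

/-- A (shelled) tiling begins with a set `F` of faces when some initial segment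
of its tiles partitions exactly `F`. -/
def Tiling.BeginsWith {S : RelCplx W} {N : ℕ} (T : Tiling S N)
    (F : Finset (Finset W)) : Prop :=
  ∃ p ≤ N, T.prefixFaces p = F

/-- A Morse tiling: all tiles are Morse tiles. -/
def Tiling.IsMorse {S : RelCplx W} {N : ℕ} (T : Tiling S N) : Prop :=
  ∀ i, ∃ n k, IsMorseTile (T.tile i) n k

/-- An h-tiling: all tiles are basic or critical tiles. -/
def Tiling.IsH {S : RelCplx W} {N : ℕ} (T : Tiling S N) : Prop :=
  ∀ i, (∃ n k, IsBasicTile (T.tile i) n k) ∨ (∃ n k, IsCriticalTile (T.tile i) n k)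

/-- `f` induces a simplicial isomorphism from `A` onto `B` (both viewed through
their collections of faces). -/
def IsSimplicialIso (f : V → W) (A : Finset (Finset V)) (B : Finset (Finset W)) : Prop :=
  Set.BijOn (fun σ : Finset V => σ.image f) ↑A ↑B

/-- `f` induces an isomorphism of relative simplicial complexes. -/
def IsRelIso (f : V → W) (S : RelCplx V) (S' : RelCplx W) : Prop :=
  Set.BijOn (fun σ : Finset V => σ.image f) ↑S.K ↑S'.K ∧
    Set.BijOn (fun σ : Finset V => σ.image f) ↑S.L ↑S'.L

/-- The first derived neighborhood `N(L, K)` of a subcomplex `L` in `K` : the union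
of the stars in `sd K` of the vertices of `L`. -/
def derivedNbhd (L K : Finset (Finset V)) : Finset (Finset (Finset V)) :=
  (L.filter fun s => s.card = 1).biUnion fun s => star (sd K) {s}

/-- The faces of the derived neighborhood `N(T, S)` of a tile `T` in a relative
complex `S`: the union of the relative stars in `sd S` of the vertices of `T`. -/
def relDerivedNbhd (T S : RelCplx V) : Finset (Finset (Finset V)) :=
  ((suppK T).biUnion fun v => ((S.sdR).starR {({v} : Finset V)}).faces) ∩ (S.sdR).faces

/-- A discrete Morse function on the finite simplicial complex `K`. -/
def IsDiscreteMorse (K : Finset (Finset V)) (f : Finset V → ℝ) : Prop :=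
  ∀ σ ∈ K, σ ≠ ∅ →
    (K.filter fun τ => σ ⊂ τ ∧ f τ ≤ f σ).card ≤ 1 ∧
    (K.filter fun θ => θ ≠ ∅ ∧ θ ⊂ σ ∧ f σ ≤ f θ).card ≤ 1

/-- A critical face of a discrete Morse function. -/
def IsCriticalFace (K : Finset (Finset V)) (f : Finset V → ℝ) (σ : Finset V) : Prop :=
  σ ∈ K ∧ σ ≠ ∅ ∧ (∀ τ ∈ K, σ ⊂ τ → f σ < f τ) ∧
    ∀ θ ∈ K, θ ≠ ∅ → θ ⊂ σ → f θ < f σ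

/-- An elementary collapse: removal of a facet `τ` together with a ridge `θ` of it
contained in no other facet. -/
def ElementaryCollapse (K K' : Finset (Finset V)) : Prop :=
  ∃ τ ∈ K, ∃ θ ∈ K, θ ⊆ τ ∧ τ.card = θ.card + 1 ∧
    (∀ ρ ∈ K, τ ⊆ ρ → ρ = τ) ∧
    (∀ ρ ∈ K, θ ⊆ ρ → ρ = θ ∨ ρ = τ) ∧
    K' = (K.erase τ).erase θ

/-- A finite simplicial complex is collapsible when some finite sequence of
elementary collapses reduces it to a single vertex. -/
def Collapsible (K : Finset (Finset V)) : Prop :=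
  ∃ v : V, Relation.ReflTransGen ElementaryCollapse K {∅, {v}}

section Assembly

variable {W : Type*} [DecidableEq W]

/-- The faces of `F` which avoid `P` are the faces containing `r` and not contained in `μ`. -/
def IsTileForm (F : Finset W) (P : Finset W → Prop) (r μ : Finset W) : Prop :=
  r ⊆ μ ∧ μ ⊂ F ∧ ∀ S ⊆ F, (¬ P S ↔ r ⊆ S ∧ ¬ S ⊆ μ)

/-- The faces of `F` satisfying `P` are those missing from a regular Morse tile on `F`. -/
def IsRegularForm (F : Finset W) (P : Finset W → Prop) : Prop :=
  ∃ r μ, IsTileForm F P r μ ∧ r ≠ μ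

theorem below_image_erase (F r : Finset W) :
    below F (r.image fun v => F.erase v) = F.powerset.filter fun S => ¬ r ⊆ S := by
  ext S
  simp only [below, Finset.mem_filter, Finset.mem_powerset, Finset.mem_image,
    exists_exists_and_eq_and, and_congr_right_iff]
  intro hS
  constructor
  · rintro ⟨v, hv, h⟩ hrS
    exact absurd (h (hrS hv)) (by simp)
  · intro h
    obtain ⟨v, hv, hvS⟩ := Finset.not_subset.1 h
    exact ⟨v, hv, fun x hx => Finset.mem_erase.2 ⟨fun e => hvS (e ▸ hx), hS hx⟩⟩

theorem eq_image_restSet (F : Finset W) (R : Finset (Finset W)) (hR : R ⊆ ridges F) :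
    R = (restSet F R).image fun v => F.erase v := by
  ext ρ
  simp only [restSet, Finset.mem_image, Finset.mem_filter]
  constructor
  · intro h
    obtain ⟨v, hv, rfl⟩ := Finset.mem_image.1 (hR h)
    exact ⟨v, ⟨hv, h⟩, rfl⟩
  · rintro ⟨v, ⟨-, h⟩, rfl⟩
    exact h

theorem IsTileForm.isMorseTile {F : Finset W} {P : Finset W → Prop} [DecidablePred P]
    {r μ : Finset W} (h : IsTileForm F P r μ) :
    ∃ n k, IsMorseTile ⟨F.powerset, F.powerset.filter P⟩ n k := by
  obtain ⟨hrμ, hμF, hP⟩ := h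
  have hcard := Finset.card_lt_card hμF
  have hridge : ∀ s ⊆ F, (s.image fun v => F.erase v) ⊆ ridges F := fun s hs =>
    Finset.image_subset_image hs
  by_cases hc : μ.card + 2 ≤ F.card
  · refine ⟨F.card - 1, _, F, by omega, rfl, r.image fun v => F.erase v,
      hridge _ (hrμ.trans hμF.1), rfl, Or.inr ⟨μ, hμF.1, ?_, hc, ?_⟩⟩
    · rw [below_image_erase]
      simp [hrμ]
    · rw [below_image_erase]
      ext S
      simp only [below, Finset.mem_filter, Finset.mem_union, Finset.mem_powerset,
        Finset.mem_singleton, exists_eq_left, ← and_or_left, and_congr_right_iff]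
      intro hS
      have := hP S hS
      tauto
  · obtain ⟨v, hv⟩ : ∃ v, F \ μ = {v} := by
      rw [← Finset.card_eq_one, Finset.card_sdiff_of_subset hμF.1]
      omega
    have hvF : v ∈ F ∧ v ∉ μ := by
      have : v ∈ F \ μ := by simp [hv]
      simpa using this
    have hsub : insert v r ⊆ F := Finset.insert_subset hvF.1 (hrμ.trans hμF.1)
    refine ⟨F.card - 1, _, F, by omega, rfl, (insert v r).image fun v => F.erase v,
      hridge _ hsub, rfl, Or.inl ?_⟩
    rw [below_image_erase]
    refine Finset.filter_congr fun S hS => ?_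
    have hS := Finset.mem_powerset.1 hS
    have key : ¬ S ⊆ μ ↔ v ∈ S := by
      constructor
      · intro h
        obtain ⟨x, hx, hxμ⟩ := Finset.not_subset.1 h
        have : x ∈ F \ μ := Finset.mem_sdiff.2 ⟨hS hx, hxμ⟩
        rw [hv, Finset.mem_singleton] at this
        exact this ▸ hx
      · exact fun h h' => hvF.2 (h' h)
    have := hP S hS
    rw [key] at this
    rw [Finset.insert_subset_iff]
    tauto

theorem IsRegularForm.not_isCriticalTile {F : Finset W} {P : Finset W → Prop} [DecidablePred P]
    (h : IsRegularForm F P) (n k : ℕ) :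
    ¬ IsCriticalTile ⟨F.powerset, F.powerset.filter P⟩ n k := by
  obtain ⟨r, μ, ⟨hrμ, hμF, hP⟩, hne⟩ := h
  rintro ⟨σ, -, hσ, hL⟩
  obtain rfl : F = σ := Finset.powerset_injective hσ
  rcases hL with ⟨-, hL⟩ | ⟨-, R, hR, -, hL⟩
  · have hμ : P μ := by
      by_contra hμ
      exact ((hP μ hμF.1).1 hμ).2 subset_rfl
    have : μ ∈ F.powerset.filter P := Finset.mem_filter.2 ⟨Finset.mem_powerset.2 hμF.1, hμ⟩
    simp only at hL
    rw [hL] at this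
    simp at this
  · obtain ⟨y, hyμ, hyr⟩ := Finset.exists_of_ssubset (hrμ.ssubset_of_ne hne)
    have hqF : restSet F R ⊆ F := Finset.filter_subset _ _
    rw [show below F R = below F ((restSet F R).image fun v => F.erase v) by
        rw [← eq_image_restSet F R hR], below_image_erase] at hL
    set q := restSet F R with hq
    have hnew : ∀ S ⊆ F, ((r ⊆ S ∧ ¬ S ⊆ μ) ↔ q ⊆ S ∧ ¬ S ⊆ q) := by
      intro S hS
      rw [← hP S hS]
      have := congrArg (fun X => S ∈ X) hL
      simp only [below, Finset.mem_filter, Finset.mem_union, Finset.mem_powerset,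
        Finset.mem_singleton, exists_eq_left, hS, true_and, eq_iff_iff] at this
      tauto
    have hyF := hμF.1 hyμ
    by_cases hyq : y ∈ q
    · have h1 := (hnew F subset_rfl).1 ⟨hrμ.trans hμF.1, hμF.2⟩
      have h2 : r ⊆ F.erase y ∧ ¬ F.erase y ⊆ μ := by
        refine ⟨fun x hx => Finset.mem_erase.2 ⟨fun e => hyr (e ▸ hx), hμF.1 (hrμ hx)⟩, ?_⟩
        intro h
        refine hμF.2 fun x hx => ?_
        by_cases e : x = y
        · exact e ▸ hyμ
        · exact h (Finset.mem_erase.2 ⟨e, hx⟩)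
      have h3 := ((hnew _ (Finset.erase_subset _ _)).1 h2).1 hyq
      simp at h3
    · have h1 := (hnew (insert y q) (Finset.insert_subset hyF hqF)).2
        ⟨Finset.subset_insert _ _, fun h => hyq (h (Finset.mem_insert_self _ _))⟩
      have h2 := (hnew q hqF).1 ⟨?_, ?_⟩
      · exact h2.2 subset_rfl
      · intro x hx
        rcases Finset.mem_insert.1 (h1.1 hx) with rfl | h
        · exact absurd hx hyr
        · exact h
      · exact fun h => h1.2 (Finset.insert_subset hyμ h)

/-- If the facets of `X` are linearly ordered by `key` in such a way that each of them meets the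
union of the smaller ones in nothing or along the missing faces of a regular Morse tile,
then `X` has a Morse shelling whose only critical tile is its first one. -/
theorem exists_morse_shelling_of_key {κ : Type*} [LinearOrder κ] (X Φ : Finset (Finset W))
    (hΦ : Φ.Nonempty) (key : Finset W → κ) (hkey : Set.InjOn key Φ)
    (hfacet : ∀ F ∈ Φ, F ∈ X ∧ ∀ S ∈ X, F ⊆ S → S = F) (hne : ∀ F ∈ Φ, F.Nonempty)
    (hX : IsComplex X) (hcov : ∀ S ∈ X, ∃ F ∈ Φ, S ⊆ F)
    (hform : ∀ F ∈ Φ, (∀ G ∈ Φ, ¬ key G < key F) ∨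
      IsRegularForm F fun S => ∃ G ∈ Φ, key G < key F ∧ S ⊆ G) :
    ∃ (N : ℕ) (Tl : Tiling (toRel X) N),
      Tl.IsMorse ∧ Tl.IsShelling ∧
      ∃ i₀ : Fin N, IsClosedSimplexTile (Tl.tile i₀) ∧
        (∃ n, IsCriticalTile (Tl.tile i₀) n 0) ∧
        ∀ i : Fin N, (∃ n k, IsCriticalTile (Tl.tile i) n k) → i = i₀ := by
  classical
  set o := (Φ.image key).orderEmbOfFin rfl with ho
  have hex : ∀ i, ∃ F ∈ Φ, key F = o i := fun i =>
    Finset.mem_image.1 (Finset.orderEmbOfFin_mem _ rfl i)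
  choose F hF hFo using hex
  have hlt : ∀ i j, key (F i) < key (F j) ↔ i < j := fun i j => by simp [hFo]
  have hsurj : ∀ G ∈ Φ, ∃ i, F i = G := by
    intro G hG
    have : key G ∈ Set.range o := by
      rw [ho, Finset.range_orderEmbOfFin]
      exact Finset.mem_coe.2 (Finset.mem_image_of_mem _ hG)
    obtain ⟨i, hi⟩ := this
    exact ⟨i, hkey (hF i) hG ((hFo i).trans hi)⟩
  set P : Fin (Φ.image key).card → Finset W → Prop := fun i S => ∃ j < i, S ⊆ F j with hPdef
  have hP : ∀ i, (fun S => ∃ G ∈ Φ, key G < key (F i) ∧ S ⊆ G) = P i := by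
    intro i
    funext S
    refine propext ⟨?_, ?_⟩
    · rintro ⟨G, hG, hlt', hS⟩
      obtain ⟨j, rfl⟩ := hsurj G hG
      exact ⟨j, (hlt _ _).1 hlt', hS⟩
    · rintro ⟨j, hj, hS⟩
      exact ⟨F j, hF j, (hlt _ _).2 hj, hS⟩
  have hmem : ∀ i S, S ∈ (F i).powerset \ (F i).powerset.filter (P i) ↔
      S ⊆ F i ∧ ∀ j < i, ¬ S ⊆ F j := by
    intro i S
    simp only [Finset.mem_sdiff, Finset.mem_filter, Finset.mem_powerset, hPdef]
    push Not
    tauto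
  have hleast : ∀ i S, S ⊆ F i → ∃ i' ≤ i, S ⊆ F i' ∧ ∀ j < i', ¬ S ⊆ F j := by
    intro i S hS
    obtain ⟨i', hi', hmin⟩ := Finset.exists_min_image
      (Finset.univ.filter fun i => S ⊆ F i) id ⟨i, by simpa using hS⟩
    simp only [Finset.mem_filter, Finset.mem_univ, true_and, id] at hi' hmin
    exact ⟨i', hmin i hS, hi', fun j hj h => absurd (hmin j h) (not_le.2 hj)⟩
  let Tl : Tiling (toRel X) (Φ.image key).card :=
    { tile := fun i => ⟨(F i).powerset, (F i).powerset.filter (P i)⟩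
      isFacet := fun i => ⟨F i, (hfacet _ (hF i)).1, (hfacet _ (hF i)).2, rfl⟩
      subL := fun i => Finset.filter_subset _ _
      disj := by
        intro i j hij
        rw [Finset.disjoint_left]
        intro S hi hj
        have hi := (hmem i S).1 hi
        have hj := (hmem j S).1 hj
        rcases lt_or_gt_of_ne hij with h | h
        · exact hj.2 i h hi.1
        · exact hi.2 j h hj.1
      cover := by
        ext S
        simp only [Finset.mem_biUnion, Finset.mem_univ, true_and, RelCplx.faces, toRel,
          Finset.sdiff_empty]
        constructor
        · rintro ⟨i, hi⟩
          exact hX _ (hfacet _ (hF i)).1 _ ((hmem i S).1 hi).1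
        · intro hS
          obtain ⟨G, hG, hSG⟩ := hcov S hS
          obtain ⟨i, rfl⟩ := hsurj G hG
          obtain ⟨i', -, h⟩ := hleast i S hSG
          exact ⟨i', (hmem i' S).2 h⟩ }
  have hpos : 0 < (Φ.image key).card := Finset.card_pos.2 (hΦ.image key)
  let i₀ : Fin (Φ.image key).card := ⟨0, hpos⟩
  have h0 : ∀ j, ¬ j < i₀ := fun j hj => Nat.not_lt_zero _ (Fin.lt_def.1 hj)
  have hL0 : (F i₀).powerset.filter (P i₀) = ∅ := by
    refine Finset.filter_eq_empty_iff.2 fun S _ => ?_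
    rintro ⟨j, hj, -⟩
    exact h0 j hj
  have hreg : ∀ i, i ≠ i₀ → IsRegularForm (F i) (P i) := by
    intro i hi
    rcases hform _ (hF i) with h | h
    · refine absurd ((hlt i₀ i).2 ?_) (h _ (hF i₀))
      exact Fin.lt_def.2 (Nat.pos_of_ne_zero fun e => hi (Fin.ext e))
    · rwa [hP] at h
  have hcard := Finset.card_pos.2 (hne _ (hF i₀))
  refine ⟨_, Tl, ?_, ?_, i₀, ⟨F i₀, rfl, hL0⟩,
    ⟨(F i₀).card - 1, F i₀, by omega, rfl, Or.inl ⟨rfl, hL0⟩⟩, ?_⟩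
  · intro i
    by_cases hi : i = i₀
    · subst hi
      refine ⟨(F i₀).card - 1, 0, F i₀, by omega, rfl, ∅, by simp, rfl, Or.inl ?_⟩
      exact hL0.trans (by simp [below])
    · obtain ⟨r, μ, h, -⟩ := hreg i hi
      exact h.isMorseTile
  · intro p _ S hS T hT
    simp only [toRel, Finset.empty_union, Tiling.prefixFaces, Finset.mem_biUnion,
      Finset.mem_filter, Finset.mem_univ, true_and] at hS ⊢
    obtain ⟨i, hip, hi⟩ := hS
    obtain ⟨i', hi', h⟩ := hleast i T (hT.trans ((hmem i S).1 hi).1)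
    exact ⟨i', lt_of_le_of_lt hi' hip, (hmem i' T).2 h⟩
  · rintro i ⟨n, k, h⟩
    by_contra hi
    exact (hreg i hi).not_isCriticalTile n k h

end Assembly

section Flags

variable {U : Type*} [DecidableEq U]

/-- The flag obtained by adding to `c` the vertices of a list one after the other
(`c` itself is left out). -/
def flag (c : Finset U) : List U → Finset (Finset U)
  | [] => ∅
  | b :: l => insert (insert b c) (flag (insert b c) l)

/-- The list `l` enumerates without repetition the vertices to be added to `c` in order to get
some facet of `L`. -/
def Completes (L : Finset (Finset U)) (c : Finset U) : List U → Prop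
  | [] => c ∈ L ∧ ∀ s ∈ L, c ⊆ s → s = c
  | b :: l => b ∉ c ∧ Completes L (insert b c) l

/-- The flag `S` avoids `insert b c`, and `b` can be replaced by a vertex satisfying `p`. -/
def Shifts (L : Finset (Finset U)) (c : Finset U) (p : U → Prop) (b : U)
    (S : Finset (Finset U)) : Prop :=
  insert b c ∉ S ∧ ∃ y, y ∉ c ∧ insert y c ∈ L ∧ p y ∧ ∀ s ∈ S, y ∈ s

/-- The faces `S` of `flag c l` which are contained in a lexicographically smaller flag. -/
def Old (L : Finset (Finset U)) (ρ : U → ℕ) (c : Finset U) : List U → Finset (Finset U) → Prop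
  | [], _ => False
  | b :: l, S => Shifts L c (fun y => ρ y < ρ b) b S ∨
      Old L ρ (insert b c) l (S.erase (insert b c))

/-- The same as `Old` for complete flags: first vertices are compared by `ρ₀`, and the other
vertices of flags starting at `a` are compared by `ρ a`. -/
def OldTop (L : Finset (Finset U)) (ρ₀ : U → ℕ) (ρ : U → U → ℕ) :
    List U → Finset (Finset U) → Prop
  | [], _ => False
  | a :: l, S => Shifts L ∅ (fun y => ρ₀ y < ρ₀ a) a S ∨
      Old L (ρ a) (insert a ∅) l (S.erase (insert a ∅))

/-- The lexicographic key of a list. -/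
def lexKey (ρ₀ : U → ℕ) (ρ : U → U → ℕ) : List U → List ℕ
  | [] => []
  | a :: l => ρ₀ a :: l.map (ρ a)

variable {L : Finset (Finset U)}

theorem Completes.mem (hL : IsComplex L) {c : Finset U} {l : List U} (h : Completes L c l) :
    c ∈ L := by
  induction l generalizing c with
  | nil => exact h.1
  | cons b l ih => exact hL _ (ih h.2) _ (Finset.subset_insert _ _)

theorem ssubset_of_mem_flag {c s : Finset U} {l : List U} (h : Completes L c l)
    (hs : s ∈ flag c l) : c ⊂ s := by
  induction l generalizing c with
  | nil => simp [flag] at hs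
  | cons b l ih =>
    have hb := Finset.ssubset_insert h.1
    rcases Finset.mem_insert.1 hs with rfl | hs
    · exact hb
    · exact hb.trans (ih h.2 hs)

theorem mem_of_mem_flag (hL : IsComplex L) {c s : Finset U} {l : List U} (h : Completes L c l)
    (hs : s ∈ flag c l) : s ∈ L := by
  induction l generalizing c with
  | nil => simp [flag] at hs
  | cons b l ih =>
    rcases Finset.mem_insert.1 hs with rfl | hs
    · exact h.2.mem hL
    · exact ih h.2 hs

theorem insert_notMem_flag {c : Finset U} {b : U} {l : List U} (h : Completes L c (b :: l)) :
    insert b c ∉ flag (insert b c) l := fun hs =>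
  (ssubset_of_mem_flag h.2 hs).ne rfl

theorem insert_subset_of_mem_flag_cons {c s : Finset U} {b : U} {l : List U}
    (h : Completes L c (b :: l)) (hs : s ∈ flag c (b :: l)) : insert b c ⊆ s := by
  rcases Finset.mem_insert.1 hs with rfl | hs
  · exact subset_rfl
  · exact (ssubset_of_mem_flag h.2 hs).1

theorem flag_chain {c : Finset U} {l : List U} (h : Completes L c l) :
    ∀ s ∈ flag c l, ∀ t ∈ flag c l, s ⊆ t ∨ t ⊆ s := by
  induction l generalizing c with
  | nil => simp [flag]
  | cons b l ih =>
    intro s hs t ht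
    rcases Finset.mem_insert.1 hs with rfl | hs'
    · exact Or.inl (insert_subset_of_mem_flag_cons h ht)
    rcases Finset.mem_insert.1 ht with rfl | ht'
    · exact Or.inr (insert_subset_of_mem_flag_cons h hs)
    exact ih h.2 s hs' t ht'

theorem erase_subset_flag {c : Finset U} {b : U} {l : List U} {S : Finset (Finset U)}
    (hS : S ⊆ flag c (b :: l)) : S.erase (insert b c) ⊆ flag (insert b c) l :=
  Finset.subset_insert_iff.1 hS

/-- A set comparable with all members of a flag and containing its base belongs to the flag,
provided that the flag ends with a facet. -/
theorem mem_flag_of_comparable {c t : Finset U} {l : List U} (h : Completes L c l) (ht : t ∈ L)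
    (hct : c ⊆ t) (hcomp : ∀ s ∈ flag c l, s ⊆ t ∨ t ⊆ s) : t = c ∨ t ∈ flag c l := by
  induction l generalizing c with
  | nil => exact Or.inl (h.2 t ht hct)
  | cons b l ih =>
    rcases hcomp _ (Finset.mem_insert_self _ _) with h' | h'
    · right
      exact Finset.mem_insert.2 (ih h.2 h' fun s hs => hcomp s (Finset.mem_insert_of_mem hs))
    · by_cases hb : b ∈ t
      · right
        rw [h'.antisymm (Finset.insert_subset hb hct)]
        exact Finset.mem_insert_self _ _
      · left
        refine Finset.Subset.antisymm (fun x hx => ?_) hct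
        rcases Finset.mem_insert.1 (h' hx) with rfl | hx'
        · exact absurd hx hb
        · exact hx'

theorem exists_completes (hL : IsComplex L) {c : Finset U} (hc : c ∈ L)
    {S : Finset (Finset U)} (hSL : S ⊆ L) (hchain : ∀ s ∈ S, ∀ t ∈ S, s ⊆ t ∨ t ⊆ s)
    (hcS : ∀ s ∈ S, c ⊆ s) :
    ∃ l, Completes L c l ∧ S ⊆ insert c (flag c l) := by
  induction hn : (L.filter (c ⊂ ·)).card using Nat.strong_induction_on generalizing c S with
  | _ n ih =>
  have step : ∀ x, x ∉ c → insert x c ∈ L → (∀ s ∈ S.erase c, x ∈ s) →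
      ∃ l, Completes L c l ∧ S ⊆ insert c (flag c l) := by
    intro x hx hxL hxS
    have hlt : (L.filter (insert x c ⊂ ·)).card < n := by
      rw [← hn]
      refine Finset.card_lt_card ((Finset.ssubset_iff_of_subset ?_).2 ⟨insert x c, ?_, ?_⟩)
      · intro s hs
        simp only [Finset.mem_filter] at hs ⊢
        exact ⟨hs.1, (Finset.ssubset_insert hx).trans hs.2⟩
      · simpa [hxL] using Finset.ssubset_insert hx
      · simp
    obtain ⟨l, hl, hSl⟩ := ih _ hlt hxL (S := S.erase c)
      ((Finset.erase_subset _ _).trans hSL)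
      (fun s hs t ht => hchain s (Finset.mem_of_mem_erase hs) t (Finset.mem_of_mem_erase ht))
      (fun s hs => Finset.insert_subset (hxS s hs) (hcS s (Finset.mem_of_mem_erase hs))) rfl
    exact ⟨x :: l, ⟨hx, hl⟩, Finset.subset_insert_iff.2 hSl⟩
  by_cases hS : (S.erase c).Nonempty
  · obtain ⟨s, hs, hmin⟩ := Finset.exists_min_image (S.erase c) Finset.card hS
    have hs' := Finset.mem_erase.1 hs
    obtain ⟨x, hxs, hxc⟩ := Finset.exists_of_ssubset ((hcS s hs'.2).ssubset_of_ne hs'.1.symm)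
    refine step x hxc (hL s (hSL hs'.2) _ (Finset.insert_subset hxs (hcS s hs'.2))) ?_
    intro t ht
    rcases hchain s hs'.2 t (Finset.mem_of_mem_erase ht) with h | h
    · exact h hxs
    · rw [Finset.eq_of_subset_of_card_le h (hmin t ht)]
      exact hxs
  · have hS : S.erase c = ∅ := Finset.not_nonempty_iff_eq_empty.1 hS
    by_cases hmax : ∀ s ∈ L, c ⊆ s → s = c
    · exact ⟨[], ⟨hc, hmax⟩, Finset.subset_insert_iff.2 (by simp [hS])⟩
    · push Not at hmax
      obtain ⟨s, hs, hcs, hne⟩ := hmax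
      obtain ⟨x, hxs, hxc⟩ := Finset.exists_of_ssubset (hcs.ssubset_of_ne hne.symm)
      exact step x hxc (hL s hs _ (Finset.insert_subset hxs hcs)) (by simp [hS])

theorem not_completes_nil_and_cons (hL : IsComplex L) {c : Finset U} {b : U} {l : List U}
    (h : Completes L c []) (h' : Completes L c (b :: l)) : False := by
  have := h.2 _ (h'.2.mem hL) (Finset.subset_insert _ _)
  exact h'.1 (this ▸ Finset.mem_insert_self _ _)

theorem eq_of_map_eq (hL : IsComplex L) {ρ : U → ℕ} (hρ : Set.InjOn ρ {x | {x} ∈ L})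
    {c : Finset U} {l l' : List U} (h : Completes L c l) (h' : Completes L c l')
    (e : l.map ρ = l'.map ρ) : l = l' := by
  induction l generalizing c l' with
  | nil => exact (List.map_eq_nil_iff.1 e.symm).symm
  | cons b l ih =>
    cases l' with
    | nil => simp at e
    | cons b' l' =>
      simp only [List.map_cons, List.cons.injEq] at e
      obtain rfl : b = b' := hρ (hL _ (h.2.mem hL) _ (by simp)) (hL _ (h'.2.mem hL) _ (by simp)) e.1
      rw [ih h.2 h'.2 e.2]

theorem shifts_of_ne {c : Finset U} {p : U → Prop} {b b' : U} {l' : List U}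
    {S : Finset (Finset U)} (hL : IsComplex L)
    (h' : Completes L c (b' :: l')) (hp : p b') (hne : b ≠ b')
    (hS' : S ⊆ flag c (b' :: l')) : Shifts L c p b S := by
  refine ⟨fun hb => ?_, b', h'.1, h'.2.mem hL, hp, fun s hs =>
    insert_subset_of_mem_flag_cons h' (hS' hs) (Finset.mem_insert_self _ _)⟩
  have := insert_subset_of_mem_flag_cons h' (hS' hb) (Finset.mem_insert_self _ _)
  rcases Finset.mem_insert.1 this with e | e
  · exact hne e.symm
  · exact h'.1 e

theorem old_of_lt (hL : IsComplex L) {ρ : U → ℕ} (hρ : Set.InjOn ρ {x | {x} ∈ L})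
    {c : Finset U} {l l' : List U} {S : Finset (Finset U)}
    (h : Completes L c l) (h' : Completes L c l') (hS : S ⊆ flag c l) (hS' : S ⊆ flag c l')
    (hlt : l'.map ρ < l.map ρ) : Old L ρ c l S := by
  induction l generalizing c l' S with
  | nil => simp at hlt
  | cons b l ih =>
    cases l' with
    | nil => exact (not_completes_nil_and_cons hL h' h).elim
    | cons b' l' =>
      rw [List.map_cons, List.map_cons, List.cons_lt_cons_iff] at hlt
      rcases hlt with hlt | ⟨e, hlt⟩
      · exact Or.inl (shifts_of_ne hL h' hlt (by rintro rfl; exact lt_irrefl _ hlt) hS')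
      · obtain rfl : b' = b :=
          hρ (hL _ (h'.2.mem hL) _ (by simp)) (hL _ (h.2.mem hL) _ (by simp)) e
        exact Or.inr (ih h.2 h'.2 (erase_subset_flag hS) (erase_subset_flag hS') hlt)

theorem Shifts.exists_completes {c : Finset U} {p : U → Prop} {b : U} {l : List U}
    {S : Finset (Finset U)} (hL : IsComplex L) (h : Completes L c (b :: l))
    (hS : S ⊆ flag c (b :: l)) (hs : Shifts L c p b S) :
    ∃ y l', p y ∧ Completes L c (y :: l') ∧ S ⊆ flag c (y :: l') := by
  obtain ⟨-, y, hyc, hyL, hy, hyS⟩ := hs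
  obtain ⟨l', hl', hSl'⟩ := MorseShelling.exists_completes hL hyL
    (fun s hs => mem_of_mem_flag hL h (hS hs))
    (fun s hs t ht => flag_chain h s (hS hs) t (hS ht))
    (fun s hs => Finset.insert_subset (hyS s hs) (ssubset_of_mem_flag h (hS hs)).1)
  exact ⟨y, l', hy, ⟨hyc, hl'⟩, hSl'⟩

theorem Old.exists_lt (hL : IsComplex L) {ρ : U → ℕ} {c : Finset U} {l : List U}
    {S : Finset (Finset U)} (h : Completes L c l) (hS : S ⊆ flag c l) (hO : Old L ρ c l S) :
    ∃ l', Completes L c l' ∧ S ⊆ flag c l' ∧ l'.map ρ < l.map ρ := by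
  induction l generalizing c S with
  | nil => exact hO.elim
  | cons b l ih =>
    rcases hO with hO | hO
    · obtain ⟨y, l', hy, h', hS'⟩ := hO.exists_completes hL h hS
      exact ⟨y :: l', h', hS', by
        rw [List.map_cons, List.map_cons, List.cons_lt_cons_iff]; exact Or.inl hy⟩
    · obtain ⟨l', h', hS', hlt⟩ := ih h.2 (erase_subset_flag hS) hO
      exact ⟨b :: l', ⟨h.1, h'⟩, Finset.subset_insert_iff.2 hS', by
        rw [List.map_cons, List.map_cons, List.cons_lt_cons_iff]; exact Or.inr ⟨rfl, hlt⟩⟩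

variable {ρ₀ : U → ℕ} {ρ : U → U → ℕ}

theorem eq_of_lexKey_eq (hL : IsComplex L) (hρ₀ : Set.InjOn ρ₀ {x | {x} ∈ L})
    (hρ : ∀ a, Set.InjOn (ρ a) {x | {x} ∈ L}) {l l' : List U} (h : Completes L ∅ l)
    (h' : Completes L ∅ l') (e : lexKey ρ₀ ρ l = lexKey ρ₀ ρ l') : l = l' := by
  match l, l' with
  | [], [] => rfl
  | [], _ :: _ => simp [lexKey] at e
  | _ :: _, [] => simp [lexKey] at e
  | a :: l, a' :: l' =>
    simp only [lexKey, List.cons.injEq] at e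
    obtain rfl : a = a' := hρ₀ (hL _ (h.2.mem hL) _ (by simp)) (hL _ (h'.2.mem hL) _ (by simp)) e.1
    rw [eq_of_map_eq hL (hρ a) h.2 h'.2 e.2]

theorem oldTop_of_lt (hL : IsComplex L) (hρ₀ : Set.InjOn ρ₀ {x | {x} ∈ L})
    (hρ : ∀ a, Set.InjOn (ρ a) {x | {x} ∈ L}) {l l' : List U} {S : Finset (Finset U)}
    (h : Completes L ∅ l) (h' : Completes L ∅ l') (hS : S ⊆ flag ∅ l) (hS' : S ⊆ flag ∅ l')
    (hlt : lexKey ρ₀ ρ l' < lexKey ρ₀ ρ l) : OldTop L ρ₀ ρ l S := by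
  match l, l' with
  | [], _ => simp [lexKey] at hlt
  | _ :: _, [] => exact (not_completes_nil_and_cons hL h' h).elim
  | b :: l, b' :: l' =>
    rw [lexKey, lexKey, List.cons_lt_cons_iff] at hlt
    rcases hlt with hlt | ⟨e, hlt⟩
    · exact Or.inl (shifts_of_ne hL h' hlt (by rintro rfl; exact lt_irrefl _ hlt) hS')
    · obtain rfl : b' = b :=
        hρ₀ (hL _ (h'.2.mem hL) _ (by simp)) (hL _ (h.2.mem hL) _ (by simp)) e
      exact Or.inr (old_of_lt hL (hρ b') h.2 h'.2 (erase_subset_flag hS)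
        (erase_subset_flag hS') hlt)

theorem OldTop.exists_lt (hL : IsComplex L) {l : List U} {S : Finset (Finset U)}
    (h : Completes L ∅ l) (hS : S ⊆ flag ∅ l) (hO : OldTop L ρ₀ ρ l S) :
    ∃ l', Completes L ∅ l' ∧ S ⊆ flag ∅ l' ∧ lexKey ρ₀ ρ l' < lexKey ρ₀ ρ l := by
  match l with
  | [] => exact hO.elim
  | b :: l =>
    rcases hO with hO | hO
    · obtain ⟨y, l', hy, h', hS'⟩ := hO.exists_completes hL h hS
      exact ⟨y :: l', h', hS', by rw [lexKey, lexKey, List.cons_lt_cons_iff]; exact Or.inl hy⟩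
    · obtain ⟨l', h', hS', hlt⟩ := hO.exists_lt hL h.2 (erase_subset_flag hS)
      exact ⟨b :: l', ⟨h.1, h'⟩, Finset.subset_insert_iff.2 hS', by
        rw [lexKey, lexKey, List.cons_lt_cons_iff]; exact Or.inr ⟨rfl, hlt⟩⟩

end Flags

section Forms

section Insert

variable {W : Type*} [DecidableEq W] {F : Finset W} {x : W} {Q P : Finset W → Prop}

theorem isTileForm_insert_of_forall (hx : x ∉ F) (hQx : ∀ S, Q S → x ∉ S)
    (hQ : ∀ S ⊆ F, Q S) (hP : ∀ S ⊆ F, ¬ P S) :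
    IsTileForm (insert x F) (fun S => Q S ∨ P (S.erase x)) ∅ F := by
  refine ⟨Finset.empty_subset _, Finset.ssubset_insert hx, fun S hS => ?_⟩
  have h1 := hP _ (Finset.subset_insert_iff.1 hS)
  have h2 := hQx S
  by_cases hxS : x ∈ S
  · have h3 : ¬ S ⊆ F := fun h => hx (h hxS)
    simp only [Finset.empty_subset, true_and]
    tauto
  · have h3 : S ⊆ F := by
      have := Finset.subset_insert_iff.1 hS
      rwa [Finset.erase_eq_of_notMem hxS] at this
    simp [h3, hQ S h3]

theorem IsTileForm.insert_of_forall {r μ : Finset W} (h : IsTileForm F P r μ) (hx : x ∉ F)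
    (hQx : ∀ S, Q S → x ∉ S) (hQ : ∀ S ⊆ F, Q S) :
    IsTileForm (insert x F) (fun S => Q S ∨ P (S.erase x)) (insert x r) (insert x μ) := by
  obtain ⟨hrμ, hμF, hP⟩ := h
  have hxμ : x ∉ μ := fun h => hx (hμF.1 h)
  have hxr : x ∉ r := fun h => hxμ (hrμ h)
  refine ⟨Finset.insert_subset_insert _ hrμ, ?_, fun S hS => ?_⟩
  · refine (Finset.insert_subset_insert _ hμF.1).ssubset_of_ne fun e => hμF.ne ?_
    rw [← Finset.erase_insert hxμ, e, Finset.erase_insert hx]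
  · have h1 := hP _ (Finset.subset_insert_iff.1 hS)
    have h2 := hQx S
    rw [Finset.insert_subset_iff, Finset.subset_insert_iff]
    rw [Finset.subset_erase] at h1
    by_cases hxS : x ∈ S
    · tauto
    · have h3 : S ⊆ F := by
        have := Finset.subset_insert_iff.1 hS
        rwa [Finset.erase_eq_of_notMem hxS] at this
      simp [hxS, hQ S h3]

theorem IsTileForm.insert_of_imp {r μ : Finset W} (h : IsTileForm F P r μ) (hx : x ∉ F)
    (hQx : ∀ S, Q S → x ∉ S) (hQ : ∀ S ⊆ F, S.Nonempty → Q S → P S) :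
    IsTileForm (insert x F) (fun S => Q S ∨ P (S.erase x)) r (insert x μ) := by
  obtain ⟨hrμ, hμF, hP⟩ := h
  have hxμ : x ∉ μ := fun h => hx (hμF.1 h)
  have hxr : x ∉ r := fun h => hxμ (hrμ h)
  refine ⟨hrμ.trans (Finset.subset_insert _ _), ?_, fun S hS => ?_⟩
  · refine (Finset.insert_subset_insert _ hμF.1).ssubset_of_ne fun e => hμF.ne ?_
    rw [← Finset.erase_insert hxμ, e, Finset.erase_insert hx]
  · have h1 := hP _ (Finset.subset_insert_iff.1 hS)
    have h2 : Q S → P (S.erase x) := by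
      intro hq
      have hxS := hQx S hq
      rw [Finset.erase_eq_of_notMem hxS] at h1 ⊢
      rcases S.eq_empty_or_nonempty with rfl | hne
      · by_contra h
        exact (h1.1 h).2 (Finset.empty_subset _)
      · refine hQ S ?_ hne hq
        have := Finset.subset_insert_iff.1 hS
        rwa [Finset.erase_eq_of_notMem hxS] at this
    rw [Finset.subset_insert_iff]
    rw [Finset.subset_erase] at h1
    tauto

theorem isTileForm_insert_of_empty (hQx : ∀ S, Q S → x ∉ S)
    (hQ : ∀ S ⊆ F, S.Nonempty → Q S → P S) (hP : ∀ S ⊆ F, ¬ P S) (h0 : Q ∅) :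
    IsTileForm (insert x F) (fun S => Q S ∨ P (S.erase x)) ∅ ∅ := by
  refine ⟨subset_rfl, (Finset.insert_nonempty _ _).empty_ssubset, fun S hS => ?_⟩
  have h1 := hP _ (Finset.subset_insert_iff.1 hS)
  simp only [h1, or_false, Finset.empty_subset, true_and, Finset.subset_empty]
  refine ⟨?_, fun hne hq => ?_⟩
  · rintro h rfl
    exact h h0
  · rw [Finset.erase_eq_of_notMem (hQx S hq)] at h1
    have hSF := Finset.subset_insert_iff.1 hS
    rw [Finset.erase_eq_of_notMem (hQx S hq)] at hSF
    exact h1 (hQ S hSF (Finset.nonempty_iff_ne_empty.2 hne) hq)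

theorem forall_not_insert_of_not_empty (hQx : ∀ S, Q S → x ∉ S)
    (hQ : ∀ S ⊆ F, S.Nonempty → Q S → P S) (hP : ∀ S ⊆ F, ¬ P S) (h0 : ¬ Q ∅) :
    ∀ S ⊆ insert x F, ¬ (Q S ∨ P (S.erase x)) := by
  rintro S hS (hq | hp)
  · have hSF := Finset.subset_insert_iff.1 hS
    rw [Finset.erase_eq_of_notMem (hQx S hq)] at hSF
    rcases S.eq_empty_or_nonempty with rfl | hne
    · exact h0 hq
    · exact hP S hSF (hQ S hSF hne hq)
  · exact hP _ (Finset.subset_insert_iff.1 hS) hp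

end Insert

variable {U : Type*} [DecidableEq U] {L : Finset (Finset U)} {ρ : U → ℕ}
  {c : Finset U} {b : U} {l : List U} {p : U → Prop}

theorem shifts_of_cons {u : U} {S : Finset (Finset U)} (hL : IsComplex L)
    (h : Completes L c (b :: u :: l)) (hu : p u) (hS : S ⊆ flag (insert b c) (u :: l)) :
    Shifts L c p b S := by
  refine ⟨fun hb => insert_notMem_flag h (hS hb), u,
    fun huc => h.2.1 (Finset.mem_insert_of_mem huc), ?_, hu, fun s hs =>
      insert_subset_of_mem_flag_cons h.2 (hS hs) (Finset.mem_insert_self _ _)⟩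
  exact hL _ (h.2.2.mem hL) _ (Finset.insert_subset_insert _ (Finset.subset_insert _ _))

/-- In the link of `insert b c`, the vertices satisfying `p` come first. -/
def ComesFirst (L : Finset (Finset U)) (ρ : U → ℕ) (c : Finset U) (p : U → Prop) : Prop :=
  ∀ y u, y ∉ c → insert y c ∈ L → p y → u ∉ c → insert u c ∈ L → ¬ p u → ρ y < ρ u

theorem Shifts.old {S : Finset (Finset U)} (hL : IsComplex L) (h : Completes L c (b :: l))
    (hpb : ¬ p b) (hfirst : ComesFirst L ρ (insert b c) p) (hl : ∀ u l', l = u :: l' → ¬ p u)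
    (hS : S ⊆ flag (insert b c) l) (hne : S.Nonempty) (hs : Shifts L c p b S) :
    Old L ρ (insert b c) l S := by
  obtain ⟨-, y, hyc, -, hy, hyS⟩ := hs
  match l with
  | [] => exact absurd hne (by simp [Finset.subset_empty.1 hS])
  | u :: l =>
    have hu := hl u l rfl
    have hyb : y ∉ insert b c := by
      rw [Finset.mem_insert, not_or]
      exact ⟨fun e => hpb (e ▸ hy), hyc⟩
    have hyL : insert y (insert b c) ∈ L := by
      obtain ⟨s, hs⟩ := hne
      exact hL _ (mem_of_mem_flag hL h.2 (hS hs)) _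
        (Finset.insert_subset (hyS s hs) (ssubset_of_mem_flag h.2 (hS hs)).1)
    refine Or.inl ⟨fun hmem => ?_, y, hyb, hyL,
      hfirst y u hyb hyL hy h.2.1 (h.2.2.mem hL) hu, hyS⟩
    rcases Finset.mem_insert.1 (hyS _ hmem) with e | e
    · exact hu (e ▸ hy)
    · exact hyb e

theorem step_form (hL : IsComplex L) (h : Completes L c (b :: l)) (hpb : ¬ p b)
    (hfirst : ComesFirst L ρ (insert b c) p)
    (hform : (∀ S ⊆ flag (insert b c) l, ¬ Old L ρ (insert b c) l S) ∨
      ∃ r μ, IsTileForm (flag (insert b c) l) (Old L ρ (insert b c) l) r μ) :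
    (∀ S ⊆ flag c (b :: l), ¬ (Shifts L c p b S ∨
      Old L ρ (insert b c) l (S.erase (insert b c)))) ∨
    ∃ r μ, IsTileForm (flag c (b :: l)) (fun S => Shifts L c p b S ∨
      Old L ρ (insert b c) l (S.erase (insert b c))) r μ := by
  have hx := insert_notMem_flag h
  have hQx : ∀ S, Shifts L c p b S → insert b c ∉ S := fun S hS => hS.1
  by_cases hdesc : ∃ u l', l = u :: l' ∧ p u
  · obtain ⟨u, l', rfl, hu⟩ := hdesc
    have hQ := fun S hS => shifts_of_cons (S := S) hL h hu hS
    rcases hform with hf | ⟨r, μ, hf⟩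
    · exact Or.inr ⟨_, _, isTileForm_insert_of_forall hx hQx hQ hf⟩
    · exact Or.inr ⟨_, _, hf.insert_of_forall hx hQx hQ⟩
  · push Not at hdesc
    have hQ := fun S hS hne hs => Shifts.old (S := S) hL h hpb hfirst hdesc hS hne hs
    rcases hform with hf | ⟨r, μ, hf⟩
    · by_cases h0 : Shifts L c p b ∅
      · exact Or.inr ⟨_, _, isTileForm_insert_of_empty hQx hQ hf h0⟩
      · exact Or.inl (forall_not_insert_of_not_empty hQx hQ hf h0)
    · exact Or.inr ⟨_, _, hf.insert_of_imp hx hQx hQ⟩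

theorem step_regularForm (hL : IsComplex L) (h : Completes L c (b :: l)) (hpb : ¬ p b)
    (hfirst : ComesFirst L ρ (insert b c) p)
    (hconn : (∃ y, y ∉ c ∧ insert y c ∈ L ∧ p y) →
      ∃ y, y ∉ insert b c ∧ insert y (insert b c) ∈ L ∧ p y)
    (hform : (∀ S ⊆ flag (insert b c) l, ¬ Old L ρ (insert b c) l S) ∨
      ∃ r μ, IsTileForm (flag (insert b c) l) (Old L ρ (insert b c) l) r μ)
    (hreg : (∃ u l', l = u :: l' ∧ p u) →
      (∀ S ⊆ flag (insert b c) l, ¬ Old L ρ (insert b c) l S) ∨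
      IsRegularForm (flag (insert b c) l) (Old L ρ (insert b c) l)) :
    (∀ S ⊆ flag c (b :: l), ¬ (Shifts L c p b S ∨
      Old L ρ (insert b c) l (S.erase (insert b c)))) ∨
    IsRegularForm (flag c (b :: l)) (fun S => Shifts L c p b S ∨
      Old L ρ (insert b c) l (S.erase (insert b c))) := by
  have hx := insert_notMem_flag h
  have hQx : ∀ S, Shifts L c p b S → insert b c ∉ S := fun S hS => hS.1
  by_cases hdesc : ∃ u l', l = u :: l' ∧ p u
  · have hreg := hreg hdesc
    obtain ⟨u, l', rfl, hu⟩ := hdesc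
    have hQ := fun S hS => shifts_of_cons (S := S) hL h hu hS
    rcases hreg with hf | ⟨r, μ, hf, hne⟩
    · exact Or.inr ⟨_, _, isTileForm_insert_of_forall hx hQx hQ hf,
        (Finset.insert_ne_empty _ _).symm⟩
    · refine Or.inr ⟨_, _, hf.insert_of_forall hx hQx hQ, fun e => hne ?_⟩
      have hxμ : insert b c ∉ μ := fun h => hx (hf.2.1.1 h)
      rw [← Finset.erase_insert hxμ, ← e, Finset.erase_insert fun h => hxμ (hf.1 h)]
  · push Not at hdesc
    have hQ := fun S hS hne hs => Shifts.old (S := S) hL h hpb hfirst hdesc hS hne hs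
    rcases hform with hf | ⟨r, μ, hf⟩
    · by_cases h0 : Shifts L c p b ∅
      · exfalso
        obtain ⟨-, y, hyc, hyL, hy, -⟩ := h0
        obtain ⟨z, hz, hzL, hpz⟩ := hconn ⟨y, hyc, hyL, hy⟩
        match l with
        | [] => exact hz (h.2.2 _ hzL (Finset.subset_insert _ _) ▸ Finset.mem_insert_self _ _)
        | u :: l =>
          exact hf ∅ (Finset.empty_subset _) (Or.inl ⟨by simp, z, hz, hzL,
            hfirst z u hz hzL hpz h.2.1 (h.2.2.mem hL) (hdesc u l rfl), by simp⟩)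
      · exact Or.inl (forall_not_insert_of_not_empty hQx hQ hf h0)
    · refine Or.inr ⟨_, _, hf.insert_of_imp hx hQx hQ, fun e => ?_⟩
      exact hx (hf.2.1.1 (hf.1 (e ▸ Finset.mem_insert_self _ _)))

theorem comesFirst_lt (n : ℕ) : ComesFirst L ρ c fun y => ρ y < n :=
  fun _ _ _ _ hy _ _ hu => lt_of_lt_of_le hy (not_lt.1 hu)

theorem old_form (hL : IsComplex L) (h : Completes L c l) :
    (∀ S ⊆ flag c l, ¬ Old L ρ c l S) ∨ ∃ r μ, IsTileForm (flag c l) (Old L ρ c l) r μ := by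
  induction l generalizing c with
  | nil => exact Or.inl fun _ _ h => h
  | cons b l ih => exact step_form hL h (lt_irrefl _) (comesFirst_lt _) (ih h.2)

/-- Orders on the vertices of `L` (by `ρ₀`) and on the vertices of their links (by `ρ a` in the
link of `a`) such that neighbours of `a` smaller than `a` come first in the link of `a`, and
such that only the smallest vertex of `L` has no smaller neighbour, the same being true in the
links of the simplices made of neighbours of `a` smaller than `a`. -/
structure IsGoodOrder (L : Finset (Finset U)) (ρ₀ : U → ℕ) (ρ : U → U → ℕ) : Prop where
  injOn₀ : Set.InjOn ρ₀ {x | {x} ∈ L}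
  injOn : ∀ a, Set.InjOn (ρ a) {x | {x} ∈ L}
  comesFirst : ∀ a, ComesFirst L (ρ a) {a} fun y => ρ₀ y < ρ₀ a
  connected₀ : ∀ a, {a} ∈ L → (∃ y, {y} ∈ L ∧ ρ₀ y < ρ₀ a) →
    ∃ y, y ≠ a ∧ {y, a} ∈ L ∧ ρ₀ y < ρ₀ a
  connected : ∀ a, ∀ c ∈ L, a ∈ c → (∀ x ∈ c, x ≠ a → ρ₀ x < ρ₀ a) →
    ∀ b, b ∉ c → insert b c ∈ L → ρ₀ b < ρ₀ a → (∀ x ∈ c, x ≠ a → ρ a b < ρ a x) →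
    (∃ y, y ∉ c ∧ insert y c ∈ L ∧ ρ a y < ρ a b) →
    ∃ y, y ∉ insert b c ∧ insert y (insert b c) ∈ L ∧ ρ a y < ρ a b

variable {ρ₀ : U → ℕ} {ρ : U → U → ℕ}

theorem IsGoodOrder.old_regularForm (hL : IsComplex L) (hgood : IsGoodOrder L ρ₀ ρ) {a : U}
    (h : Completes L c l) (hac : a ∈ c) (hcA : ∀ x ∈ c, x ≠ a → ρ₀ x < ρ₀ a)
    (hl : ∀ u l', l = u :: l' → ρ₀ u < ρ₀ a ∧ ∀ x ∈ c, x ≠ a → ρ a u < ρ a x) :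
    (∀ S ⊆ flag c l, ¬ Old L (ρ a) c l S) ∨ IsRegularForm (flag c l) (Old L (ρ a) c l) := by
  induction l generalizing c with
  | nil => exact Or.inl fun _ _ h => h
  | cons b l ih =>
    obtain ⟨hbA, hbc⟩ := hl b l rfl
    refine step_regularForm hL h (lt_irrefl _) (comesFirst_lt _)
      (hgood.connected a c (h.mem hL) hac hcA b h.1 (h.2.mem hL) hbA hbc)
      (old_form hL h.2) ?_
    rintro ⟨u, l', rfl, hu⟩
    refine ih h.2 (Finset.mem_insert_of_mem hac) ?_ ?_
    · intro x hx hxa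
      rcases Finset.mem_insert.1 hx with rfl | hx
      · exact hbA
      · exact hcA x hx hxa
    · rintro _ _ ⟨⟩
      refine ⟨?_, ?_⟩
      · have hne : ∀ v, v ∉ c → v ∉ ({a} : Finset U) := fun v hv hva =>
          hv (Finset.mem_singleton.1 hva ▸ hac)
        have hmem : ∀ v, insert v (insert b c) ∈ L → insert v {a} ∈ L := fun v hv =>
          hL _ hv _ (Finset.insert_subset_insert _
            (Finset.singleton_subset_iff.2 (Finset.mem_insert_of_mem hac)))
        by_contra hu'
        exact absurd (hgood.comesFirst a b u (hne b h.1)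
          (hmem b (by simpa using h.2.mem hL)) hbA
          (hne u fun hh => h.2.1 (Finset.mem_insert_of_mem hh)) (hmem u (h.2.2.mem hL)) hu')
          (not_lt.2 hu.le)
      · intro x hx hxa
        rcases Finset.mem_insert.1 hx with rfl | hx
        · exact hu
        · exact hu.trans (hbc x hx hxa)

theorem IsGoodOrder.oldTop_regularForm (hL : IsComplex L) (hgood : IsGoodOrder L ρ₀ ρ)
    (h : Completes L ∅ l) :
    (∀ S ⊆ flag ∅ l, ¬ OldTop L ρ₀ ρ l S) ∨ IsRegularForm (flag ∅ l) (OldTop L ρ₀ ρ l) := by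
  match l with
  | [] => exact Or.inl fun _ _ h => h
  | a :: l =>
    refine step_regularForm hL h (lt_irrefl _) (hgood.comesFirst a) ?_ (old_form hL h.2) ?_
    · rintro ⟨y, -, hyL, hy⟩
      obtain ⟨z, hz, hzL, hza⟩ := hgood.connected₀ a (h.2.mem hL) ⟨y, hyL, hy⟩
      exact ⟨z, by simpa using hz, hzL, hza⟩
    · rintro ⟨u, l', rfl, hu⟩
      refine hgood.old_regularForm hL h.2 (Finset.mem_insert_self _ _) (by simp) ?_
      rintro _ _ ⟨⟩
      exact ⟨hu, by simp⟩

theorem mem_sd {c : Finset (Finset U)} (h0 : ∅ ∈ L) :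
    c ∈ sd L ↔ (∀ s ∈ c, s ≠ ∅ ∧ s ∈ L) ∧ ∀ s ∈ c, ∀ t ∈ c, s ⊆ t ∨ t ⊆ s := by
  rw [sd, if_neg (Finset.ne_empty_of_mem h0), Finset.mem_filter, Finset.mem_powerset]
  simp only [Finset.subset_iff, Finset.mem_erase]

theorem isComplex_sd (h0 : ∅ ∈ L) : IsComplex (sd L) := by
  intro c hc d hd
  rw [mem_sd h0] at hc ⊢
  exact ⟨fun s hs => hc.1 s (hd hs), fun s hs t ht => hc.2 s (hd hs) t (hd ht)⟩

theorem flag_mem_sd (hL : IsComplex L) (h0 : ∅ ∈ L) (h : Completes L ∅ l) : flag ∅ l ∈ sd L :=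
  (mem_sd h0).2 ⟨fun _ hs => ⟨(ssubset_of_mem_flag h hs).ne', mem_of_mem_flag hL h hs⟩,
    flag_chain h⟩

theorem IsGoodOrder.exists_morse_shelling (hL : IsComplex L) (h0 : ∃ v, {v} ∈ L)
    (hgood : IsGoodOrder L ρ₀ ρ) :
    ∃ (N : ℕ) (Tl : Tiling (toRel (sd L)) N),
      Tl.IsMorse ∧ Tl.IsShelling ∧
      ∃ i₀ : Fin N, IsClosedSimplexTile (Tl.tile i₀) ∧
        (∃ n, IsCriticalTile (Tl.tile i₀) n 0) ∧
        ∀ i : Fin N, (∃ n k, IsCriticalTile (Tl.tile i) n k) → i = i₀ := by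
  classical
  obtain ⟨v, hv⟩ := h0
  have h0 : ∅ ∈ L := hL _ hv _ (Finset.empty_subset _)
  have hnew : ∀ l, Completes L ∅ l → ¬ OldTop L ρ₀ ρ l (flag ∅ l) := by
    intro l hl
    rcases hgood.oldTop_regularForm hL hl with h | ⟨r, μ, ⟨hrμ, hμ, h⟩, -⟩
    · exact h _ subset_rfl
    · exact (h _ subset_rfl).2 ⟨hrμ.trans hμ.1, hμ.2⟩
  have hinj : ∀ l l', Completes L ∅ l → Completes L ∅ l' → flag ∅ l = flag ∅ l' → l = l' := by
    intro l l' hl hl' e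
    rcases lt_trichotomy (lexKey ρ₀ ρ l) (lexKey ρ₀ ρ l') with hlt | heq | hlt
    · exact absurd (oldTop_of_lt hL hgood.injOn₀ hgood.injOn hl' hl subset_rfl e.ge hlt)
        (hnew l' hl')
    · exact eq_of_lexKey_eq hL hgood.injOn₀ hgood.injOn hl hl' heq
    · exact absurd (oldTop_of_lt hL hgood.injOn₀ hgood.injOn hl hl' subset_rfl e.le hlt)
        (hnew l hl)
  set Φ := (sd L).filter fun F => ∃ l, Completes L ∅ l ∧ flag ∅ l = F with hΦ
  have hex : ∀ F, ∃ l, F ∈ Φ → Completes L ∅ l ∧ flag ∅ l = F := by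
    intro F
    by_cases hF : F ∈ Φ
    · obtain ⟨l, hl⟩ := (Finset.mem_filter.1 hF).2
      exact ⟨l, fun _ => hl⟩
    · exact ⟨[], fun h => absurd h hF⟩
  choose lst hlst using hex
  have hmemΦ : ∀ l, Completes L ∅ l → flag ∅ l ∈ Φ ∧ lst (flag ∅ l) = l := by
    intro l hl
    have hmem : flag ∅ l ∈ Φ := Finset.mem_filter.2 ⟨flag_mem_sd hL h0 hl, l, hl, rfl⟩
    exact ⟨hmem, hinj _ _ (hlst _ hmem).1 hl (hlst _ hmem).2⟩
  have hold : ∀ F ∈ Φ, ∀ S ⊆ F, ((∃ G ∈ Φ, lexKey ρ₀ ρ (lst G) < lexKey ρ₀ ρ (lst F) ∧ S ⊆ G) ↔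
      OldTop L ρ₀ ρ (lst F) S) := by
    intro F hF S hS
    obtain ⟨hl, hlF⟩ := hlst F hF
    constructor
    · rintro ⟨G, hG, hlt, hSG⟩
      obtain ⟨hl', hlG⟩ := hlst G hG
      exact oldTop_of_lt hL hgood.injOn₀ hgood.injOn hl hl' (hS.trans hlF.ge)
        (hSG.trans hlG.ge) hlt
    · intro h
      obtain ⟨l', hl', hSl', hlt⟩ := h.exists_lt hL hl (hS.trans hlF.ge)
      exact ⟨_, (hmemΦ l' hl').1, by rwa [(hmemΦ l' hl').2], hSl'⟩
  have hcov : ∀ S ∈ sd L, ∃ F ∈ Φ, S ⊆ F := by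
    intro S hS
    rw [mem_sd h0] at hS
    obtain ⟨l, hl, hSl⟩ := exists_completes hL h0 (fun s hs => (hS.1 s hs).2) hS.2
      (fun s _ => Finset.empty_subset s)
    refine ⟨_, (hmemΦ l hl).1, fun s hs => ?_⟩
    exact (Finset.mem_insert.1 (hSl hs)).resolve_left (hS.1 s hs).1
  refine exists_morse_shelling_of_key (sd L) Φ ?_ (fun F => lexKey ρ₀ ρ (lst F)) ?_ ?_ ?_
    (isComplex_sd h0) hcov ?_
  · obtain ⟨F, hF, -⟩ := hcov ∅ ((mem_sd h0).2 (by simp))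
    exact ⟨F, hF⟩
  · intro F hF G hG e
    rw [← (hlst F hF).2, ← (hlst G hG).2,
      eq_of_lexKey_eq hL hgood.injOn₀ hgood.injOn (hlst F hF).1 (hlst G hG).1 e]
  · intro F hF
    refine ⟨(Finset.mem_filter.1 hF).1, fun S hS hFS => Finset.Subset.antisymm (fun s hs => ?_) hFS⟩
    rw [mem_sd h0] at hS
    obtain ⟨hl, hlF⟩ := hlst F hF
    have := mem_flag_of_comparable hl (hS.1 s hs).2 (Finset.empty_subset _)
      (fun t ht => hS.2 t (hFS (hlF ▸ ht)) s hs)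
    exact hlF ▸ this.resolve_left (hS.1 s hs).1
  · intro F hF
    obtain ⟨hl, hlF⟩ := hlst F hF
    rw [← hlF]
    match hlst' : lst F with
    | [] =>
      rw [hlst'] at hl
      exact absurd (hl.2 _ hv (Finset.empty_subset _)) (Finset.singleton_ne_empty v)
    | a :: l => exact Finset.insert_nonempty _ _
  · intro F hF
    obtain ⟨hl, hlF⟩ := hlst F hF
    rcases hgood.oldTop_regularForm hL hl with h | ⟨r, μ, ⟨hrμ, hμ, h⟩, hne⟩
    · left
      intro G hG hlt
      exact h ∅ (Finset.empty_subset _)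
        ((hold F hF ∅ (Finset.empty_subset _)).1 ⟨G, hG, hlt, Finset.empty_subset _⟩)
    · right
      rw [hlF] at hμ h
      exact ⟨r, μ, ⟨hrμ, hμ, fun S hS =>
        (not_congr (hold F hF S hS)).trans (h S hS)⟩, hne⟩

end Forms

section Collapse

variable {V : Type*} [DecidableEq V] {K : Finset (Finset V)} {o : Finset V → ℕ}

theorem exists_injOn_refining {α : Type*} [DecidableEq α] (s : Finset α) (f : α → ℕ) :
    ∃ ρ : α → ℕ, Set.InjOn ρ s ∧ ∀ x ∈ s, ∀ y ∈ s, f x < f y → ρ x < ρ y := by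
  have hlt : ∀ x ∈ s, ∀ y ∈ s, f x < f y →
      f x * s.card + s.toList.idxOf x < f y * s.card + s.toList.idxOf y := by
    intro x hx y _ h
    have h1 : s.toList.idxOf x < s.card := by
      rw [← Finset.length_toList]
      exact List.idxOf_lt_length_of_mem (Finset.mem_toList.2 hx)
    have h2 := Nat.mul_le_mul_right s.card (Nat.succ_le_of_lt h)
    rw [Nat.succ_mul] at h2
    omega
  refine ⟨fun x => f x * s.card + s.toList.idxOf x, fun x hx y hy e => ?_, hlt⟩
  rcases lt_trichotomy (f x) (f y) with h | h | h
  · exact absurd e (hlt x hx y hy h).ne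
  · simp only [h, add_right_inj] at e
    exact (List.idxOf_inj (Finset.mem_toList.2 hx)).1 e
  · exact absurd e (hlt y hy x hx h).ne'

/-- An order on the nonempty simplices of `K` such that every simplex `a` but the first one is
preceded either by all its proper faces but one ridge and by none of its cofaces, or by all its
proper faces and exactly one of its cofaces. -/
def IsCollapseOrder (K : Finset (Finset V)) (o : Finset V → ℕ) : Prop :=
  Set.InjOn o K ∧ ∀ a ∈ K, a ≠ ∅ →
    (∀ b ∈ K, b ≠ ∅ → ¬ o b < o a) ∨
    (∃ w ∈ a, a.erase w ≠ ∅ ∧ ∀ b ∈ K, b ≠ ∅ → (b ⊆ a ∨ a ⊆ b) →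
      (o b < o a ↔ b ⊂ a ∧ b ≠ a.erase w)) ∨
    ∃ w ∈ K, a ⊂ w ∧ ∀ b ∈ K, b ≠ ∅ → (b ⊆ a ∨ a ⊆ b) → (o b < o a ↔ b ⊂ a ∨ b = w)

theorem ElementaryCollapse.isComplex {K' : Finset (Finset V)} (hK : IsComplex K)
    (h : ElementaryCollapse K K') : IsComplex K' := by
  obtain ⟨τ, -, θ, -, -, -, hτ, hθ, rfl⟩ := h
  intro σ hσ ρ hρ
  simp only [Finset.mem_erase] at hσ ⊢
  refine ⟨?_, ?_, hK σ hσ.2.2 ρ hρ⟩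
  · rintro rfl
    rcases hθ σ hσ.2.2 hρ with h | h
    · exact hσ.1 h
    · exact hσ.2.1 h
  · rintro rfl
    exact hσ.2.1 (hτ σ hσ.2.2 hρ)

theorem IsCollapseOrder.exists_of_elementaryCollapse {K' : Finset (Finset V)}
    (h0 : ∅ ∈ K') (h : ElementaryCollapse K K') (ho : IsCollapseOrder K' o) :
    ∃ o', IsCollapseOrder K o' := by
  obtain ⟨τ, hτK, θ, hθK, hθτ, hcard, hτ, hθ, rfl⟩ := h
  have hne : θ ≠ τ := by
    rintro rfl
    omega
  have hθ0 : θ ≠ ∅ := fun e => by simp [e] at h0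
  have hK' : ∀ x, x ∈ (K.erase τ).erase θ ↔ x ≠ θ ∧ x ≠ τ ∧ x ∈ K := fun x => by
    simp only [Finset.mem_erase]
  set M := ((K.erase τ).erase θ).sup o + 1 with hM
  have hoM : ∀ x ∈ K, x ≠ τ → x ≠ θ → o x < M := fun x hx h1 h2 =>
    Nat.lt_succ_of_le (Finset.le_sup (f := o) ((hK' x).2 ⟨h2, h1, hx⟩))
  set o' : Finset V → ℕ := fun x => if x = τ then M else if x = θ then M + 1 else o x with ho'
  have oτ : o' τ = M := by simp [ho']
  have oθ : o' θ = M + 1 := by simp [ho', hne]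
  have oK : ∀ x, x ≠ τ → x ≠ θ → o' x = o x := fun x h1 h2 => by simp [ho', h1, h2]
  refine ⟨o', ?_, ?_⟩
  · have hval : ∀ z ∈ K, z ≠ τ → z ≠ θ → o' z < M := fun z hz h1 h2 => by
      rw [oK z h1 h2]
      exact hoM z hz h1 h2
    intro x hx y hy e
    by_cases hx1 : x = τ
    · by_cases hy1 : y = τ
      · rw [hx1, hy1]
      by_cases hy2 : y = θ
      · rw [hx1, hy2, oτ, oθ] at e
        omega
      · have := hval y hy hy1 hy2
        rw [hx1, oτ] at e
        omega
    by_cases hx2 : x = θ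
    · by_cases hy1 : y = τ
      · rw [hx2, hy1, oτ, oθ] at e
        omega
      by_cases hy2 : y = θ
      · rw [hx2, hy2]
      · have := hval y hy hy1 hy2
        rw [hx2, oθ] at e
        omega
    have hxv := hval x hx hx1 hx2
    by_cases hy1 : y = τ
    · rw [hy1, oτ] at e
      omega
    by_cases hy2 : y = θ
    · rw [hy2, oθ] at e
      omega
    rw [oK x hx1 hx2, oK y hy1 hy2] at e
    exact ho.1 ((hK' x).2 ⟨hx2, hx1, hx⟩) ((hK' y).2 ⟨hy2, hy1, hy⟩) e
  · intro a ha ha0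
    by_cases haτ : a = τ
    · subst haτ
      obtain ⟨w, hw⟩ : ∃ w, a \ θ = {w} := by
        rw [← Finset.card_eq_one, Finset.card_sdiff_of_subset hθτ]
        omega
      have hwa : w ∈ a \ θ := by simp [hw]
      have hθw : a.erase w = θ := by
        rw [Finset.erase_eq, ← hw, Finset.sdiff_sdiff_eq_self hθτ]
      refine Or.inr (Or.inl ⟨w, (Finset.mem_sdiff.1 hwa).1, hθw ▸ hθ0, fun b hb _ hba => ?_⟩)
      rw [hθw, oτ]
      by_cases h1 : b = a
      · subst h1
        simp [oτ]
      by_cases h2 : b = θ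
      · subst h2
        simp [oθ]
      rw [oK b h1 h2]
      refine iff_of_true (hoM b hb h1 h2) ⟨?_, h2⟩
      rcases hba with h | h
      · exact h.ssubset_of_ne h1
      · exact absurd (hτ b hb h) h1
    by_cases haθ : a = θ
    · subst haθ
      refine Or.inr (Or.inr ⟨τ, hτK, hθτ.ssubset_of_ne hne, fun b hb _ hba => ?_⟩)
      rw [oθ]
      by_cases h1 : b = τ
      · subst h1
        simp [oτ]
      by_cases h2 : b = a
      · subst h2
        simp [oθ, hne]
      rw [oK b h1 h2]
      refine iff_of_true ((hoM b hb h1 h2).trans (Nat.lt_succ_self _)) (Or.inl ?_)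
      rcases hba with h | h
      · exact h.ssubset_of_ne h2
      · rcases hθ b hb h with h | h
        · exact absurd h h2
        · exact absurd h h1
    have haM := hoM a ha haτ haθ
    have hτa : ¬ τ ⊂ a := fun h => haτ (hτ a ha h.1)
    have hθa : ¬ θ ⊂ a := fun h => (hθ a ha h.1).elim haθ haτ
    rw [oK a haτ haθ]
    have hext : ∀ p : Finset V → Prop,
        (∀ b ∈ (K.erase τ).erase θ, b ≠ ∅ → (b ⊆ a ∨ a ⊆ b) → (o b < o a ↔ p b)) →
        ¬ p τ → ¬ p θ → ∀ b ∈ K, b ≠ ∅ → (b ⊆ a ∨ a ⊆ b) → (o' b < o a ↔ p b) := by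
      intro p hp hpτ hpθ b hb hb0 hba
      by_cases h1 : b = τ
      · subst h1
        rw [oτ]
        exact iff_of_false (by omega) hpτ
      by_cases h2 : b = θ
      · subst h2
        rw [oθ]
        exact iff_of_false (by omega) hpθ
      rw [oK b h1 h2]
      exact hp b ((hK' b).2 ⟨h2, h1, hb⟩) hb0 hba
    rcases ho.2 a ((hK' a).2 ⟨haθ, haτ, ha⟩) ha0 with h | ⟨w, hw, hw0, h⟩ | ⟨w, hw, haw, h⟩
    · refine Or.inl fun b hb hb0 => ?_
      by_cases h1 : b = τ
      · subst h1
        rw [oτ]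
        omega
      by_cases h2 : b = θ
      · subst h2
        rw [oθ]
        omega
      rw [oK b h1 h2]
      exact h b ((hK' b).2 ⟨h2, h1, hb⟩) hb0
    · exact Or.inr (Or.inl ⟨w, hw, hw0, hext (fun b => b ⊂ a ∧ b ≠ a.erase w) h
        (fun h => hτa h.1) (fun h => hθa h.1)⟩)
    · have hw := (hK' w).1 hw
      exact Or.inr (Or.inr ⟨w, hw.2.2, haw, hext (fun b => b ⊂ a ∨ b = w) h
        (fun h => h.elim hτa hw.2.1.symm) (fun h => h.elim hθa hw.1.symm)⟩)

theorem Collapsible.exists_isCollapseOrder (hK : IsComplex K) (hc : Collapsible K) :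
    (∃ v, {v} ∈ K) ∧ ∃ o, IsCollapseOrder K o := by
  obtain ⟨v, hv⟩ := hc
  suffices h : ({v} ∈ K) ∧ ∃ o, IsCollapseOrder K o from ⟨⟨v, h.1⟩, h.2⟩
  induction hv using Relation.ReflTransGen.head_induction_on with
  | refl =>
    refine ⟨by simp, Finset.card, ?_, ?_⟩
    · intro x hx y hy
      simp only [Finset.coe_insert, Finset.coe_singleton, Set.mem_insert_iff,
        Set.mem_singleton_iff] at hx hy
      rcases hx with rfl | rfl <;> rcases hy with rfl | rfl <;> simp
    · intro a ha ha0
      simp only [Finset.mem_insert, Finset.mem_singleton] at ha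
      obtain rfl := ha.resolve_left ha0
      refine Or.inl fun b hb hb0 => ?_
      simp only [Finset.mem_insert, Finset.mem_singleton] at hb
      rw [hb.resolve_left hb0]
      exact lt_irrefl _
  | head h _ ih =>
    have hK' := h.isComplex hK
    obtain ⟨hv, o, ho⟩ := ih hK'
    obtain ⟨o', ho'⟩ := ho.exists_of_elementaryCollapse (hK' _ hv _ (Finset.empty_subset _)) h
    obtain ⟨τ, -, θ, -, -, -, -, -, rfl⟩ := h
    exact ⟨Finset.mem_of_mem_erase (Finset.mem_of_mem_erase hv), o', ho'⟩

theorem insert_mem_sd (h0 : ∅ ∈ K) {c : Finset (Finset V)} (hc : c ∈ sd K) {z : Finset V} :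
    insert z c ∈ sd K ↔ z ≠ ∅ ∧ z ∈ K ∧ ∀ x ∈ c, x ⊆ z ∨ z ⊆ x := by
  rw [mem_sd h0] at hc ⊢
  simp only [Finset.forall_mem_insert]
  constructor
  · exact fun h => ⟨h.1.1.1, h.1.1.2, fun x hx => ((h.2.2 x hx).1)⟩
  · rintro ⟨h1, h2, h3⟩
    exact ⟨⟨⟨h1, h2⟩, hc.1⟩, ⟨Or.inl subset_rfl, fun x hx => (h3 x hx).symm⟩,
      fun x hx => ⟨h3 x hx, hc.2 x hx⟩⟩

theorem singleton_mem_sd (h0 : ∅ ∈ K) {x : Finset V} : {x} ∈ sd K ↔ x ≠ ∅ ∧ x ∈ K := by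
  simp [mem_sd h0]

/-- The connectedness required by `IsGoodOrder` in the link of `a`, for vertices given by `A`. -/
def LinkConnected {U : Type*} [DecidableEq U] (L : Finset (Finset U)) (A : U → Prop) (ρ : U → ℕ)
    (a : U) : Prop :=
  ∀ c ∈ L, a ∈ c → (∀ x ∈ c, x ≠ a → A x) →
    ∀ b, b ∉ c → insert b c ∈ L → A b → (∀ x ∈ c, x ≠ a → ρ b < ρ x) →
    (∃ y, y ∉ c ∧ insert y c ∈ L ∧ ρ y < ρ b) →
    ∃ y, y ∉ insert b c ∧ insert y (insert b c) ∈ L ∧ ρ y < ρ b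

theorem linkConnected_sd (h0 : ∅ ∈ K) {A : Finset V → Prop} {ρ : Finset V → ℕ} {a : Finset V}
    (h : ∀ c ∈ sd K, a ∈ c → (∀ x ∈ c, x ≠ a → A x ∧ x ∈ K ∧ x ≠ ∅ ∧ (x ⊆ a ∨ a ⊆ x)) →
      ∀ b ∈ K, b ≠ ∅ → A b → (∀ x ∈ c, x ⊆ b ∨ b ⊆ x) → (∀ x ∈ c, x ≠ a → ρ b < ρ x) →
      (∃ y ∈ K, y ≠ ∅ ∧ y ≠ a ∧ (∀ x ∈ c, x ⊆ y ∨ y ⊆ x) ∧ ρ y < ρ b) →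
      ∃ z ∈ K, z ≠ ∅ ∧ z ≠ a ∧ (∀ x ∈ c, x ⊆ z ∨ z ⊆ x) ∧ (b ⊆ z ∨ z ⊆ b) ∧ ρ z < ρ b) :
    LinkConnected (sd K) A ρ a := by
  intro c hc hac hcA b _ hbK hbA hbc ⟨y, hy, hyK, hyb⟩
  have hb := (insert_mem_sd h0 hc).1 hbK
  have hy' := (insert_mem_sd h0 hc).1 hyK
  have hc' := (mem_sd h0).1 hc
  obtain ⟨z, hzK, hz0, hza, hzc, hzb, hlt⟩ := h c hc hac
    (fun x hx hxa => ⟨hcA x hx hxa, (hc'.1 x hx).2, (hc'.1 x hx).1, hc'.2 x hx a hac⟩)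
    b hb.2.1 hb.1 hbA hb.2.2 hbc
    ⟨y, hy'.2.1, hy'.1, fun e => hy (e ▸ hac), hy'.2.2, hyb⟩
  refine ⟨z, ?_, (insert_mem_sd h0 hbK).2 ⟨hz0, hzK, ?_⟩, hlt⟩
  · rw [Finset.mem_insert, not_or]
    refine ⟨fun e => lt_irrefl _ (e ▸ hlt), fun hz => ?_⟩
    exact lt_asymm hlt (hbc z hz hza)
  · intro x hx
    rcases Finset.mem_insert.1 hx with rfl | hx
    · exact hzb
    · exact hzc x hx

theorem comesFirst_sd (h0 : ∅ ∈ K) {p : Finset V → Prop} {ρ : Finset V → ℕ} {a : Finset V}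
    (h : ∀ y ∈ K, ∀ u ∈ K, y ≠ ∅ → u ≠ ∅ → (y ⊆ a ∨ a ⊆ y) → (u ⊆ a ∨ a ⊆ u) → p y → ¬ p u →
      ρ y < ρ u) : ComesFirst (sd K) ρ {a} p := by
  intro y u _ hyL hy _ huL hu
  rw [mem_sd h0] at hyL huL
  simp only [Finset.forall_mem_insert, Finset.mem_singleton, forall_eq] at hyL huL
  exact h y hyL.1.1.2 u huL.1.1.2 hyL.1.1.1 huL.1.1.1 hyL.2.1.2 huL.2.1.2 hy hu

/-- The case of a simplex whose proper faces but the ridge `a.erase w` come before it. -/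
theorem exists_linkConnected_of_erase (hK : IsComplex K) (h0 : ∅ ∈ K) {p : Finset V → Prop}
    {a : Finset V} (ha : a ∈ K) {w : V} (hw : w ∈ a)
    (hp : ∀ b ∈ K, b ≠ ∅ → (b ⊆ a ∨ a ⊆ b) → (p b ↔ b ⊂ a ∧ b ≠ a.erase w)) :
    ∃ ρ : Finset V → ℕ, Set.InjOn ρ K ∧ ComesFirst (sd K) ρ {a} p ∧
      LinkConnected (sd K) p ρ a := by
  set f : Finset V → ℕ := fun x => if x ⊂ a ∧ x ≠ a.erase w then
    if w ∈ x then x.card else a.card + 1 else a.card + 2 with hf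
  have hf1 : ∀ x, x ⊂ a → w ∈ x → f x = x.card := by
    intro x hx hwx
    have : x ≠ a.erase w := fun e => by simp [e] at hwx
    simp [hf, hx, this, hwx]
  have hf2 : ∀ x, x ⊂ a → x ≠ a.erase w → w ∉ x → f x = a.card + 1 := fun x h1 h2 h3 => by
    simp [hf, h1, h2, h3]
  have hf3 : ∀ x, f x ≤ a.card → x ⊂ a ∧ w ∈ x := by
    intro x hx
    by_cases h1 : x ⊂ a ∧ x ≠ a.erase w
    · refine ⟨h1.1, ?_⟩
      by_contra h3
      rw [hf2 x h1.1 h1.2 h3] at hx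
      omega
    · simp only [hf, h1, if_false] at hx
      omega
  obtain ⟨ρ, hinj, hρ⟩ := exists_injOn_refining K f
  have hρ' : ∀ x ∈ K, ∀ y ∈ K, ρ x < ρ y → f x ≤ f y := fun x hx y hy h =>
    not_lt.1 fun h' => lt_asymm h (hρ y hy x hx h')
  refine ⟨ρ, hinj, comesFirst_sd h0 ?_, linkConnected_sd h0 ?_⟩
  · intro y hy u hu hy0 hu0 hya hua hpy hpu
    rw [hp y hy hy0 hya] at hpy
    rw [hp u hu hu0 hua] at hpu
    refine hρ y hy u hu ?_
    have h1 : f u = a.card + 2 := by simp only [hf, hpu, if_false]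
    have h2 := Finset.card_lt_card hpy.1
    rw [h1]
    by_cases h3 : w ∈ y
    · rw [hf1 y hpy.1 h3]
      omega
    · rw [hf2 y hpy.1 hpy.2 h3]
      omega
  · intro c hc hac hcA b hb hb0 hpb hbc hblt ⟨y, hy, hy0, hya, hyc, hyb⟩
    have hc' := (mem_sd h0).1 hc
    have hcA' : ∀ x ∈ c, x ≠ a → x ⊂ a ∧ x ≠ a.erase w := fun x hx hxa =>
      (hp x (hcA x hx hxa).2.1 (hcA x hx hxa).2.2.1 (hcA x hx hxa).2.2.2).1 (hcA x hx hxa).1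
    have hb' := (hp b hb hb0 ((hbc a hac).symm)).1 hpb
    have hcard := Finset.card_lt_card hb'.1
    by_cases hwb : w ∈ b
    · set g := (c.filter (w ∉ ·)).sup id with hg
      have hgle : ∀ x ∈ c, w ∉ x → x ⊆ g := fun x hx hwx =>
        Finset.le_sup (f := id) (Finset.mem_filter.2 ⟨hx, hwx⟩)
      have hgsub : ∀ z, w ∈ z → (∀ x ∈ c, x ⊆ z ∨ z ⊆ x) → insert w g ⊆ z := by
        intro z hwz hz
        refine Finset.insert_subset hwz (Finset.sup_le fun x hx => ?_)
        obtain ⟨hx, hwx⟩ := Finset.mem_filter.1 hx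
        exact (hz x hx).resolve_right fun h => hwx (h hwz)
      have hgb := hgsub b hwb hbc
      have hne : insert w g ≠ b := by
        intro e
        have h1 := hρ' y hy b hb hyb
        rw [hf1 b hb'.1 hwb] at h1
        obtain ⟨hya', hwy⟩ := hf3 y (h1.trans hcard.le)
        rw [hf1 y hya' hwy] at h1
        have := Finset.eq_of_subset_of_card_le (e ▸ hgsub y hwy hyc) h1
        exact lt_irrefl _ (this ▸ hyb)
      have hga : insert w g ⊂ a := lt_of_le_of_lt hgb hb'.1
      have hgK := hK b hb _ hgb
      refine ⟨insert w g, hgK, Finset.insert_ne_empty _ _, hga.ne, ?_, Or.inr hgb, ?_⟩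
      · intro x hx
        by_cases hwx : w ∈ x
        · exact Or.inr (hgsub x hwx fun t ht => hc'.2 t ht x hx)
        · exact Or.inl ((hgle x hx hwx).trans (Finset.subset_insert _ _))
      · refine hρ _ hgK b hb ?_
        rw [hf1 _ hga (Finset.mem_insert_self _ _), hf1 b hb'.1 hwb]
        exact Finset.card_lt_card (hgb.ssubset_of_ne hne)
    · have hwc : ∀ x ∈ c, x ≠ a → w ∉ x := by
        intro x hx hxa hwx
        have h1 := hρ' b hb x (hcA x hx hxa).2.1 (hblt x hx hxa)
        rw [hf1 x (hcA' x hx hxa).1 hwx, hf2 b hb'.1 hb'.2 hwb] at h1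
        have := Finset.card_lt_card (hcA' x hx hxa).1
        omega
      obtain ⟨g, hg, hmax⟩ := Finset.exists_max_image (insert b (c.erase a)) Finset.card
        (Finset.insert_nonempty _ _)
      have hgA : g ⊂ a ∧ g ≠ a.erase w ∧ w ∉ g ∧ ∀ x ∈ insert b c, x ⊆ g ∨ g ⊆ x := by
        rcases Finset.mem_insert.1 hg with rfl | hg
        · exact ⟨hb'.1, hb'.2, hwb, Finset.forall_mem_insert _ _ _ |>.2 ⟨Or.inl subset_rfl, hbc⟩⟩
        · obtain ⟨hga, hg⟩ := Finset.mem_erase.1 hg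
          exact ⟨(hcA' g hg hga).1, (hcA' g hg hga).2, hwc g hg hga,
            Finset.forall_mem_insert _ _ _ |>.2 ⟨(hbc g hg).symm, fun x hx => hc'.2 x hx g hg⟩⟩
      obtain ⟨hga, hgw, hwg, hgcomp⟩ := hgA
      have hle : ∀ x ∈ insert b c, x ≠ a → x ⊆ g := by
        intro x hx hxa
        rcases hgcomp x hx with h | h
        · exact h
        · refine (Finset.eq_of_subset_of_card_le h (hmax x ?_)).ge
          rcases Finset.mem_insert.1 hx with rfl | hx
          · exact Finset.mem_insert_self _ _
          · exact Finset.mem_insert_of_mem (Finset.mem_erase.2 ⟨hxa, hx⟩)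
      have hza : insert w g ⊂ a := by
        refine (Finset.insert_subset hw hga.1).ssubset_of_ne fun e => hgw ?_
        rw [← e, Finset.erase_insert hwg]
      have hzK := hK a ha _ hza.1
      have hbg := (hle b (Finset.mem_insert_self _ _) hb'.1.ne).trans (Finset.subset_insert w g)
      refine ⟨insert w g, hzK, Finset.insert_ne_empty _ _, hza.ne, ?_, Or.inl hbg, ?_⟩
      · intro x hx
        by_cases hxa : x = a
        · exact Or.inr (hxa ▸ hza.1)
        · exact Or.inl ((hle x (Finset.mem_insert_of_mem hx) hxa).trans
            (Finset.subset_insert w g))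
      · refine hρ _ hzK b hb ?_
        rw [hf1 _ hza (Finset.mem_insert_self _ _), hf2 b hb'.1 hb'.2 hwb]
        exact (Finset.card_lt_card hza).trans (Nat.lt_succ_self _)

/-- The case of a simplex preceded by all its proper faces and one coface. -/
theorem exists_linkConnected_of_coface (h0 : ∅ ∈ K) {p : Finset V → Prop}
    {a w : Finset V} (hw : w ∈ K) (haw : a ⊂ w)
    (hp : ∀ b ∈ K, b ≠ ∅ → (b ⊆ a ∨ a ⊆ b) → (p b ↔ b ⊂ a ∨ b = w)) :
    ∃ ρ : Finset V → ℕ, Set.InjOn ρ K ∧ ComesFirst (sd K) ρ {a} p ∧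
      LinkConnected (sd K) p ρ a := by
  have haw' : ¬ w ⊂ a := fun h => h.2 haw.1
  set f : Finset V → ℕ := fun x => if x = w then 0 else if x ⊂ a then 1 else 2 with hf
  have hfw : f w = 0 := by simp [hf]
  have hf0 : ∀ x, x ≠ w → 0 < f x := by
    intro x hx
    simp only [hf, hx, if_false]
    split_ifs <;> omega
  obtain ⟨ρ, hinj, hρ⟩ := exists_injOn_refining K f
  refine ⟨ρ, hinj, comesFirst_sd h0 ?_, linkConnected_sd h0 ?_⟩
  · intro y hy u hu hy0 hu0 hya hua hpy hpu
    rw [hp y hy hy0 hya] at hpy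
    rw [hp u hu hu0 hua, not_or] at hpu
    refine hρ y hy u hu ?_
    have h1 : f u = 2 := by simp [hf, hpu]
    rw [h1]
    rcases hpy with h | rfl
    · have : y ≠ w := fun e => haw' (e ▸ h)
      simp [hf, this, h]
    · simp [hfw]
  · intro c _ hac hcA b hb hb0 hpb hbc hblt ⟨y, hy, _, _, _, hyb⟩
    have hsub : ∀ x ∈ K, x ≠ ∅ → (x ⊆ a ∨ a ⊆ x) → p x → x ⊆ w := by
      intro x hx hx0 hxa hpx
      rcases (hp x hx hx0 hxa).1 hpx with h | rfl
      · exact h.1.trans haw.1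
      · exact subset_rfl
    have hbw : b ≠ w := by
      rintro rfl
      have hyb' : y ≠ b := fun e => lt_irrefl _ (e ▸ hyb)
      exact lt_asymm hyb (hρ b hb y hy (hfw ▸ hf0 y hyb'))
    refine ⟨w, hw, (lt_of_le_of_lt (Finset.empty_subset a) haw).ne', haw.ne', ?_,
      Or.inl (hsub b hb hb0 (hbc a hac).symm hpb), hρ w hw b hb (hfw ▸ hf0 b hbw)⟩
    intro x hx
    by_cases hxa : x = a
    · exact Or.inl (hxa ▸ haw.1)
    · obtain ⟨h1, h2, h3, h4⟩ := hcA x hx hxa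
      exact Or.inl (hsub x h2 h3 h4 h1)

theorem IsCollapseOrder.exists_isGoodOrder (hK : IsComplex K) (h0 : ∅ ∈ K)
    (ho : IsCollapseOrder K o) : ∃ ρ, IsGoodOrder (sd K) o ρ := by
  have hsub : {x | {x} ∈ sd K} ⊆ (K : Set (Finset V)) := fun x hx =>
    ((singleton_mem_sd h0).1 hx).2
  have key : ∀ a, ∃ ρ : Finset V → ℕ, Set.InjOn ρ K ∧
      ComesFirst (sd K) ρ {a} (fun y => o y < o a) ∧
      LinkConnected (sd K) (fun y => o y < o a) ρ a := by
    intro a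
    obtain ⟨ρ, hinj, -⟩ := exists_injOn_refining K fun _ => 0
    by_cases ha : a ∈ K ∧ a ≠ ∅
    · rcases ho.2 a ha.1 ha.2 with h | ⟨w, hw, -, h⟩ | ⟨w, hw, haw, h⟩
      · refine ⟨ρ, hinj, comesFirst_sd h0 ?_, linkConnected_sd h0 ?_⟩
        · intro y hy _ _ hy0 _ _ _ hya
          exact absurd hya (h y hy hy0)
        · intro _ _ _ _ b hb hb0 hba
          exact absurd hba (h b hb hb0)
      · exact exists_linkConnected_of_erase hK h0 ha.1 hw h
      · exact exists_linkConnected_of_coface h0 hw haw h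
    · have ha' : ∀ c ∈ sd K, a ∉ c := fun c hc hac =>
        ha (((mem_sd h0).1 hc).1 a hac).symm
      exact ⟨ρ, hinj, fun y _ _ hy => absurd (by simp) (ha' _ hy),
        fun c hc hac => absurd hac (ha' c hc)⟩
  choose ρ hinj hfirst hconn using key
  refine ⟨ρ, ho.1.mono hsub, fun a => (hinj a).mono hsub, hfirst, ?_, hconn⟩
  rintro a ha ⟨y, hy, hya⟩
  rw [singleton_mem_sd h0] at ha hy
  have hpair : ∀ z ∈ K, z ≠ ∅ → (z ⊆ a ∨ a ⊆ z) → {z, a} ∈ sd K := fun z hz hz0 hza =>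
    (insert_mem_sd h0 ((singleton_mem_sd h0).2 ha)).2 ⟨hz0, hz, by simpa using hza.symm⟩
  suffices ∃ z ∈ K, z ≠ ∅ ∧ (z ⊆ a ∨ a ⊆ z) ∧ o z < o a by
    obtain ⟨z, hz, hz0, hza, hlt⟩ := this
    exact ⟨z, fun e => lt_irrefl _ (e ▸ hlt), hpair z hz hz0 hza, hlt⟩
  rcases ho.2 a ha.2 ha.1 with h | ⟨w, hw, hw0, h⟩ | ⟨w, hw, haw, h⟩
  · exact absurd hya (h y hy.2 hy.1)
  · have hwa : ({w} : Finset V) ⊆ a := Finset.singleton_subset_iff.2 hw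
    have hwK := hK a ha.2 _ hwa
    refine ⟨{w}, hwK, Finset.singleton_ne_empty w, Or.inl hwa,
      (h _ hwK (Finset.singleton_ne_empty w) (Or.inl hwa)).2 ⟨hwa.ssubset_of_ne ?_, ?_⟩⟩
    · rintro rfl
      simp at hw0
    · intro e
      have := Finset.mem_singleton_self w
      rw [e] at this
      simp at this
  · have hw0 : w ≠ ∅ := (lt_of_le_of_lt (Finset.empty_subset a) haw).ne'
    exact ⟨w, hw, hw0, Or.inr haw.1, (h w hw hw0 (Or.inr haw.1)).2 (Or.inr rfl)⟩

end Collapse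

/-- The second barycentric subdivision of any collapsible finite simplicial
complex carries a Morse shelling using one closed simplex as unique critical
tile. -/
theorem morse_shelling_of_collapsible
    {V : Type*} [DecidableEq V] (K : Finset (Finset V)) (hK : IsComplex K)
    (hc : Collapsible K) :
    ∃ (N : ℕ) (Tl : Tiling (toRel (sd (sd K))) N),
      Tl.IsMorse ∧ Tl.IsShelling ∧
      ∃ i₀ : Fin N, IsClosedSimplexTile (Tl.tile i₀) ∧
        (∃ n, IsCriticalTile (Tl.tile i₀) n 0) ∧
        ∀ i : Fin N, (∃ n k, IsCriticalTile (Tl.tile i) n k) → i = i₀ := by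
  obtain ⟨⟨v, hv⟩, o, ho⟩ := hc.exists_isCollapseOrder hK
  have h0 : ∅ ∈ K := hK _ hv _ (Finset.empty_subset _)
  obtain ⟨ρ, hρ⟩ := ho.exists_isGoodOrder hK h0
  exact hρ.exists_morse_shelling (isComplex_sd h0)
    ⟨{v}, (singleton_mem_sd h0).2 ⟨Finset.singleton_ne_empty v, hv⟩⟩

end MorseShelling
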